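/- arXiv:0901.1061 — 5 statements merged into one kernel-verified Lean document; each statement's English description precedes it below -/
import Mathlib

section
/- Let 2 ≤ N ≤ n be integers, V = ℂ^n with standard basis e_1, …, e_n, and let R ⊆ V^{⊗N} be the span of the antisymmetric tensors ∑_{σ ∈ S_N} sgn(σ) e_{i_{σ(1)}} ⊗ ⋯ ⊗ e_{i_{σ(N)}} for 1 ≤ i_1 < ⋯ < i_N ≤ n. Then the N-homogeneous algebra A = A(V,R) is N-Koszul: for every m ≥ 1, the Koszul complex K(A)_m of total degree m is exact at every position ℓ ≥ 1. -/
open scoped TensorProduct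

/-- The `k`-th tensor power `V^{⊗k}` of `V = ℂ^n`, realized concretely as the space
of `ℂ`-valued functions on words of length `k` in the letters `{1,…,n}`. -/
abbrev TP (n k : ℕ) := (Fin k → Fin n) → ℂ

/-- The concatenation (tensor) product `V^{⊗k} × V^{⊗l} → V^{⊗m}` for `k + l = m`. -/
noncomputable def mulT {n k l m : ℕ} (h : k + l = m) (f : TP n k) (g : TP n l) : TP n m :=
  fun w => f (fun i => w (Fin.cast h (Fin.castAdd l i))) *
           g (fun i => w (Fin.cast h (Fin.natAdd k i)))

/-- The slice map `V^{⊗m} → V^{⊗N}` extracting the coefficient function of the middle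
block, the prefix word `p` (length `a`) and suffix word `s` (length `b`) being fixed. -/
noncomputable def sliceMap (n N : ℕ) {a b m : ℕ} (h : a + N + b = m)
    (p : Fin a → Fin n) (s : Fin b → Fin n) : TP n m →ₗ[ℂ] TP n N :=
  LinearMap.funLeft ℂ ℂ (fun u => (Fin.append (Fin.append p u) s) ∘ Fin.cast h.symm)

/-- The subspace `V^{⊗a} ⊗ R ⊗ V^{⊗b}` of `V^{⊗m}` (for `a + N + b = m`), described as
the set of tensors all of whose middle slices lie in `R ⊆ V^{⊗N}`. -/
noncomputable def midSub (n N : ℕ) (R : Submodule ℂ (TP n N)) {a b m : ℕ}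
    (h : a + N + b = m) : Submodule ℂ (TP n m) :=
  ⨅ (p : Fin a → Fin n) (s : Fin b → Fin n), R.comap (sliceMap n N h p s)

/-- The degree-`k` part `∑_{a+N+b=k} V^{⊗a} ⊗ R ⊗ V^{⊗b}` of the two-sided ideal `(R)`. -/
noncomputable def idealSub (n N : ℕ) (R : Submodule ℂ (TP n N)) (k : ℕ) :
    Submodule ℂ (TP n k) :=
  ⨆ (ab : ℕ × ℕ) (h : ab.1 + N + ab.2 = k), midSub n N R h

/-- The degree-`k` homogeneous component `A_k = V^{⊗k} / ∑_{a+N+b=k} V^{⊗a} ⊗ R ⊗ V^{⊗b}`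
of the `N`-homogeneous algebra `A = A(V,R)`. -/
noncomputable abbrev Acomp (n N : ℕ) (R : Submodule ℂ (TP n N)) (k : ℕ) :=
  TP n k ⧸ idealSub n N R k

/-- `W_m = ⋂_{a+N+b=m} V^{⊗a} ⊗ R ⊗ V^{⊗b}` (so `W_m = V^{⊗m}` for `m < N`). -/
noncomputable def Wcomp (n N : ℕ) (R : Submodule ℂ (TP n N)) (m : ℕ) :
    Submodule ℂ (TP n m) :=
  ⨅ (ab : ℕ × ℕ) (h : ab.1 + N + ab.2 = m), midSub n N R h

/-- The jump map `ν_N : ℕ → ℕ`, `ν_N(2i) = Ni`, `ν_N(2i+1) = Ni + 1`. -/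
def nuN (N l : ℕ) : ℕ := N * (l / 2) + l % 2

/-- `KoszulDiff n N R m d` says that `d ℓ` is, for each `ℓ` with `ν_N(ℓ+1) ≤ m`, the
Koszul differential `A_{m-ν_N(ℓ+1)} ⊗ W_{ν_N(ℓ+1)} → A_{m-ν_N(ℓ)} ⊗ W_{ν_N(ℓ)}` of the
total-degree-`m` part `K(A)_m` of the Koszul complex: writing `w ∈ W_{ν_N(ℓ+1)}` as
`∑ᵢ vᵢ ⊗ wᵢ` with `vᵢ ∈ V^{⊗s}`, `wᵢ ∈ W_{ν_N(ℓ)}` (`s = ν_N(ℓ+1) − ν_N(ℓ)`), it sends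
`(class of u) ⊗ w` to `∑ᵢ (class of u·vᵢ) ⊗ wᵢ`. -/
noncomputable def KoszulDiff (n N : ℕ) (R : Submodule ℂ (TP n N)) (m : ℕ)
    (d : ∀ ℓ : ℕ,
      (Acomp n N R (m - nuN N (ℓ+1)) ⊗[ℂ] Wcomp n N R (nuN N (ℓ+1))) →ₗ[ℂ]
      (Acomp n N R (m - nuN N ℓ) ⊗[ℂ] Wcomp n N R (nuN N ℓ))) : Prop :=
  ∀ (ℓ : ℕ), nuN N (ℓ+1) ≤ m →
    ∀ (hs : (nuN N (ℓ+1) - nuN N ℓ) + nuN N ℓ = nuN N (ℓ+1))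
      (hk : (m - nuN N (ℓ+1)) + (nuN N (ℓ+1) - nuN N ℓ) = m - nuN N ℓ)
      (u : TP n (m - nuN N (ℓ+1))) (w : Wcomp n N R (nuN N (ℓ+1)))
      (q : ℕ) (v : Fin q → TP n (nuN N (ℓ+1) - nuN N ℓ))
      (w' : Fin q → Wcomp n N R (nuN N ℓ)),
      (w : TP n (nuN N (ℓ+1))) = ∑ i, mulT hs (v i) (w' i) →
      d ℓ ((idealSub n N R _).mkQ u ⊗ₜ[ℂ] w) =
        ∑ i, (idealSub n N R _).mkQ (mulT hk u (v i)) ⊗ₜ[ℂ] w' i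

/-- The space of antisymmetric tensors of degree `N` over `V = ℂ^n`: the span of the
tensors `∑_{σ ∈ S_N} sgn(σ) e_{i_{σ(1)}} ⊗ ⋯ ⊗ e_{i_{σ(N)}}`, `1 ≤ i₁ < ⋯ < i_N ≤ n`
(the basis tensor `e_{u_1} ⊗ ⋯ ⊗ e_{u_N}` is the indicator function of the word `u`). -/
noncomputable def antisymR (n N : ℕ) : Submodule ℂ (TP n N) :=
  Submodule.span ℂ {f : TP n N | ∃ g : Fin N → Fin n, StrictMono g ∧
    f = ∑ σ : Equiv.Perm (Fin N), (Equiv.Perm.sign σ : ℤ) •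
          fun u : Fin N → Fin n => if u = g ∘ σ then (1 : ℂ) else 0}

section LeadingTerms

variable {n m : ℕ}

/-- `w` is the lexicographically smallest word in the support of `x`. -/
def IsLead (x : TP n m) (w : Fin m → Fin n) : Prop :=
  x w ≠ 0 ∧ ∀ w', toLex w' < toLex w → x w' = 0

lemma exists_isLead {x : TP n m} (hx : x ≠ 0) : ∃ w, IsLead x w := by
  obtain ⟨w₀, hw₀⟩ := Function.ne_iff.1 hx
  obtain ⟨w, hw, hmin⟩ := (Set.toFinite {w | x w ≠ 0}).exists_minimalFor toLex _ ⟨w₀, hw₀⟩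
  refine ⟨w, hw, fun w' hw' => ?_⟩
  by_contra h
  exact absurd (hmin h hw'.le) (not_le.2 hw')

lemma IsLead.eq {x : TP n m} {w w' : Fin m → Fin n} (hw₁ : IsLead x w) (hw₂ : IsLead x w') :
    w = w' := by
  rcases lt_trichotomy (toLex w) (toLex w') with hlt | heq | hlt
  · exact absurd (hw₂.2 _ hlt) hw₁.1
  · exact toLex_inj.1 heq
  · exact absurd (hw₁.2 _ hlt) hw₂.1

/-- A subspace all of whose leading words are leading words of elements lying in both
`U` and `S` is contained in `S`. -/
lemma le_of_forall_isLead {U S : Submodule ℂ (TP n m)}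
    (H : ∀ x ∈ U, ∀ w, IsLead x w → ∃ g ∈ U, g ∈ S ∧ IsLead g w) : U ≤ S := by
  have key : ∀ v : Lex (Fin m → Fin n), ∀ x ∈ U, IsLead x (ofLex v) → x ∈ S := by
    intro v
    induction v using WellFoundedGT.induction with
    | ind v ih =>
      intro x hx hlead
      obtain ⟨g, hgU, hgS, hg⟩ := H x hx _ hlead
      set c := x (ofLex v) / g (ofLex v) with hc
      have hyU : x - c • g ∈ U := U.sub_mem hx (U.smul_mem _ hgU)
      have hyS : x - c • g ∈ S := by
        by_cases h0 : x - c • g = 0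
        · rw [h0]; exact S.zero_mem
        obtain ⟨w, hw⟩ := exists_isLead h0
        refine ih (toLex w) ?_ _ hyU hw
        rcases lt_trichotomy (toLex w) v with hlt | heq | hgt
        · exact absurd (by simp [hlead.2 w hlt, hg.2 w hlt]) hw.1
        · subst heq
          refine absurd ?_ hw.1
          have : g w ≠ 0 := hg.1
          simp only [hc, ofLex_toLex, Pi.sub_apply, Pi.smul_apply, smul_eq_mul]
          field_simp
          simp
        · exact hgt
      have := S.add_mem hyS (S.smul_mem c hgS)
      simpa using this
  intro x hx
  by_cases h0 : x = 0
  · rw [h0]; exact S.zero_mem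
  obtain ⟨w, hw⟩ := exists_isLead h0
  exact key (toLex w) x hx hw

end LeadingTerms

section Alternating

variable {n m : ℕ}

/-- Tensors which are alternating in any two positions of the same colour. -/
def altSub (n : ℕ) {m : ℕ} (c : Fin m → ℕ) : Submodule ℂ (TP n m) where
  carrier := {f | ∀ i j, i ≠ j → c i = c j → ∀ w, f (w ∘ Equiv.swap i j) = - f w}
  add_mem' := by
    intro f g hf hg i j hij hc w
    simp only [Pi.add_apply, hf i j hij hc w, hg i j hij hc w]
    ring
  zero_mem' := by
    intro i j _ _ w
    simp
  smul_mem' := by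
    intro r f hf i j hij hc w
    simp only [Pi.smul_apply, hf i j hij hc w, smul_neg]

lemma altSub_mono {c c' : Fin m → ℕ} (h : ∀ i j, c' i = c' j → c i = c j) :
    altSub n c ≤ altSub n c' :=
  fun _ hf i j hij hc w => hf i j hij (h i j hc) w

/-- The word `w` is strictly increasing along the positions of each colour. -/
def Inc (c : Fin m → ℕ) (w : Fin m → Fin n) : Prop :=
  ∀ i j, i < j → c i = c j → w i < w j

lemma Inc.mono {c c' : Fin m → ℕ} (h : ∀ i j, c' i = c' j → c i = c j) {w : Fin m → Fin n}
    (hw : Inc c w) : Inc c' w :=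
  fun i j hij hc => hw i j hij (h i j hc)

/-- The alternating sum of the rearrangements of `w` by colour-preserving permutations. -/
noncomputable def altElt (c : Fin m → ℕ) (w : Fin m → Fin n) : TP n m :=
  ∑ σ : Equiv.Perm (Fin m) with ∀ i, c (σ i) = c i, (Equiv.Perm.sign σ : ℤ) •
    fun u : Fin m → Fin n => if u = w ∘ σ then (1 : ℂ) else 0

lemma altElt_apply (c : Fin m → ℕ) (w u : Fin m → Fin n) :
    altElt c w u = ∑ σ : Equiv.Perm (Fin m) with ∀ i, c (σ i) = c i,
      (Equiv.Perm.sign σ : ℤ) • (if u = w ∘ σ then (1 : ℂ) else 0) := by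
  simp [altElt, Finset.sum_apply]

lemma altElt_mem (c : Fin m → ℕ) (w : Fin m → Fin n) : altElt c w ∈ altSub n c := by
  intro i j hij hc u
  have hcs : ∀ x, c (Equiv.swap i j x) = c x := by
    intro x
    by_cases hi : x = i
    · subst hi; simp [hc]
    by_cases hj : x = j
    · subst hj; simp [hc]
    rw [Equiv.swap_apply_of_ne_of_ne hi hj]
  rw [altElt_apply, altElt_apply, ← Finset.sum_neg_distrib]
  refine Finset.sum_equiv (Equiv.mulRight (Equiv.swap i j)) ?_ ?_
  · intro σ
    simp only [Finset.mem_filter, Finset.mem_univ, true_and, Equiv.coe_mulRight,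
      Equiv.Perm.mul_apply]
    constructor
    · intro h x
      rw [h, hcs]
    · intro h x
      have := h (Equiv.swap i j x)
      rwa [Equiv.swap_apply_self, hcs] at this
  · intro σ _
    have : u ∘ Equiv.swap i j = w ∘ σ ↔ u = w ∘ (σ * Equiv.swap i j : Equiv.Perm (Fin m)) := by
      constructor
      · intro h
        funext x
        have := congrFun h (Equiv.swap i j x)
        simpa using this
      · rintro rfl
        funext x
        simp
    rw [Equiv.coe_mulRight, if_congr this rfl rfl, Equiv.Perm.sign_mul,
      Equiv.Perm.sign_swap hij]
    simp

lemma Inc.lt_comp {c : Fin m → ℕ} {w : Fin m → Fin n} (hw : Inc c w) {σ : Equiv.Perm (Fin m)}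
    (hσ : ∀ i, c (σ i) = c i) (hne : σ ≠ 1) : toLex w < toLex (w ∘ σ) := by
  have hex : ∃ i, σ i ≠ i := by
    by_contra! h
    exact hne (Equiv.ext h)
  obtain ⟨i, hi, hmin⟩ := (Set.toFinite {i | σ i ≠ i}).exists_minimal hex
  have hfix : ∀ j < i, σ j = j := by
    intro j hj
    by_contra h
    exact absurd (hmin h hj.le) (not_le.2 hj)
  refine ⟨i, fun j hj => by simp [hfix j hj], ?_⟩
  have hgt : i < σ i := by
    rcases lt_trichotomy (σ i) i with h | h | h
    · exact absurd (σ.injective (hfix _ h)) hi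
    · exact absurd h hi
    · exact h
  exact hw _ _ hgt (hσ i).symm

lemma Inc.altElt_apply_self {c : Fin m → ℕ} {w : Fin m → Fin n} (hw : Inc c w) :
    altElt c w w = 1 := by
  rw [altElt_apply, Finset.sum_eq_single 1]
  · simp
  · intro σ hσ hne
    have := hw.lt_comp (Finset.mem_filter.1 hσ).2 hne
    rw [if_neg, smul_zero]
    intro h
    rw [← h] at this
    exact lt_irrefl _ this
  · simp

lemma Inc.altElt_apply_of_lt {c : Fin m → ℕ} {w w' : Fin m → Fin n} (hw : Inc c w)
    (h : toLex w' < toLex w) : altElt c w w' = 0 := by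
  rw [altElt_apply]
  refine Finset.sum_eq_zero fun σ hσ => ?_
  rw [if_neg, smul_zero]
  rintro rfl
  by_cases hne : σ = 1
  · subst hne
    exact lt_irrefl _ h
  · exact lt_asymm h (hw.lt_comp (Finset.mem_filter.1 hσ).2 hne)

lemma Inc.isLead {c : Fin m → ℕ} {w : Fin m → Fin n} (hw : Inc c w) :
    IsLead (altElt c w) w :=
  ⟨by rw [hw.altElt_apply_self]; exact one_ne_zero, fun _ h => hw.altElt_apply_of_lt h⟩

lemma IsLead.inc {c : Fin m → ℕ} {x : TP n m} (hx : x ∈ altSub n c) {w : Fin m → Fin n}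
    (hw : IsLead x w) : Inc c w := by
  intro i j hij hc
  have hs := hx i j hij.ne hc w
  rcases lt_trichotomy (w i) (w j) with h | h | h
  · exact h
  · exfalso
    have : w ∘ Equiv.swap i j = w := by
      funext y
      by_cases hi : y = i
      · subst hi; simp [h]
      by_cases hj : y = j
      · subst hj; simp [h]
      simp [Equiv.swap_apply_of_ne_of_ne hi hj]
    rw [this] at hs
    exact hw.1 (self_eq_neg.1 hs)
  · exfalso
    have hlt : toLex (w ∘ Equiv.swap i j) < toLex w := by
      refine ⟨i, fun y hy => ?_, by simpa using h⟩
      simp [Equiv.swap_apply_of_ne_of_ne hy.ne (hy.trans hij).ne]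
    rw [hw.2 _ hlt] at hs
    exact hw.1 (by simpa using hs.symm)

/-- The colouring whose only non-trivial colour class is the interval `[a, b)`. -/
def win {m : ℕ} (a b : ℕ) (i : Fin m) : ℕ := if a ≤ i ∧ (i : ℕ) < b then a else i

lemma win_eq_iff {a b : ℕ} {i j : Fin m} :
    win a b i = win a b j ↔ i = j ∨ (a ≤ i ∧ (i : ℕ) < b ∧ a ≤ j ∧ (j : ℕ) < b) := by
  rw [Fin.ext_iff]
  unfold win
  split_ifs <;> omega

/-- The colouring with colour classes `[a, b)` and `[a', b')`, to be used when `b ≤ a'`. -/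
def win₂ {m : ℕ} (a b a' b' : ℕ) (i : Fin m) : ℕ :=
  if a ≤ i ∧ (i : ℕ) < b then a else if a' ≤ i ∧ (i : ℕ) < b' then a' else i

lemma win₂_eq_iff {a b a' b' : ℕ} (h : b ≤ a') {i j : Fin m} :
    win₂ a b a' b' i = win₂ a b a' b' j ↔ win a b i = win a b j ∨ win a' b' i = win a' b' j := by
  rw [win_eq_iff, win_eq_iff, Fin.ext_iff]
  unfold win₂
  split_ifs <;> omega

lemma win_eq_of_le {a b a' b' : ℕ} (ha : a ≤ a') (hb : b' ≤ b) (i j : Fin m)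
    (h : win a' b' i = win a' b' j) : win a b i = win a b j := by
  rw [win_eq_iff] at *
  omega

lemma Inc.union {a b a' b' : ℕ} {w : Fin m → Fin n} (h : Inc (win a b) w)
    (h' : Inc (win a' b') w) (ha : a ≤ a') (hab : a' < b) (hb : b ≤ b') : Inc (win a b') w := by
  intro i j hij hc
  have hij' : (i : ℕ) < j := hij
  rw [win_eq_iff] at hc
  have hc' : a ≤ i ∧ (j : ℕ) < b' := by omega
  by_cases hj : (j : ℕ) < b
  · exact h i j hij (win_eq_iff.2 (by omega))
  by_cases hi : a' ≤ i
  · exact h' i j hij (win_eq_iff.2 (by omega))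
  have hm := j.isLt
  let y : Fin m := ⟨a', by omega⟩
  have hy : (y : ℕ) = a' := rfl
  exact (h i y (Fin.lt_def.2 (by omega)) (win_eq_iff.2 (by omega))).trans
    (h' y j (Fin.lt_def.2 (by omega)) (win_eq_iff.2 (by omega)))

lemma altSub_union {a b a' b' : ℕ} {f : TP n m} (h : f ∈ altSub n (win a b))
    (h' : f ∈ altSub n (win a' b')) (ha : a ≤ a') (hab : a' < b) (hb : b ≤ b') :
    f ∈ altSub n (win a b') := by
  have main : ∀ i j : Fin m, i < j → a ≤ i → (j : ℕ) < b' → ∀ w,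
      f (w ∘ Equiv.swap i j) = - f w := by
    intro i j hij hai hjb w
    have hij' : (i : ℕ) < j := hij
    by_cases hj : (j : ℕ) < b
    · exact h i j hij.ne (win_eq_iff.2 (by omega)) w
    by_cases hi : a' ≤ i
    · exact h' i j hij.ne (win_eq_iff.2 (by omega)) w
    have hm := j.isLt
    let y : Fin m := ⟨a', by omega⟩
    have hy : (y : ℕ) = a' := rfl
    have hiy : i ≠ y := Fin.ne_of_val_ne (by omega)
    have hyj : y ≠ j := Fin.ne_of_val_ne (by omega)
    have e : Equiv.swap i j = Equiv.swap i y * Equiv.swap y j * Equiv.swap i y := by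
      rw [Equiv.swap_comm i y, Equiv.swap_comm y j,
        Equiv.swap_mul_swap_mul_swap hyj.symm hij.ne']
    have s1 := h i y hiy (win_eq_iff.2 (by omega))
    have s2 := h' y j hyj (win_eq_iff.2 (by omega))
    rw [e]
    have : w ∘ ⇑(Equiv.swap i y * Equiv.swap y j * Equiv.swap i y) =
        ((w ∘ Equiv.swap i y) ∘ Equiv.swap y j) ∘ Equiv.swap i y := rfl
    rw [this, s1, s2, s1]
    simp
  intro i j hij hc w
  rw [win_eq_iff] at hc
  rcases lt_or_gt_of_ne hij with hlt | hlt
  · exact main i j hlt (by omega) (by omega) w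
  · rw [Equiv.swap_comm]
    exact main j i hlt (by omega) (by omega) w

end Alternating

section Groebner

variable {n m : ℕ}

/-- The subspace `I_k ⊗ V^{⊗(m-k)}` of `V^{⊗m}`, where `I` is the ideal generated by the
alternating tensors of degree `N`. -/
def idealW (n N m k : ℕ) : Submodule ℂ (TP n m) :=
  ⨆ (a : ℕ) (_ : a + N ≤ k), altSub n (win (m := m) a (a + N))

lemma altSub_le_idealW {N k a : ℕ} (h : a + N ≤ k) :
    altSub n (win (m := m) a (a + N)) ≤ idealW n N m k :=
  le_iSup₂_of_le a h le_rfl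

/-- An alternating tensor supported above `w` lies in every subspace containing the
alternating sums of the words above `w`. -/
lemma mem_of_altElt_mem {c : Fin m → ℕ} {S : Submodule ℂ (TP n m)} {w : Fin m → Fin n}
    (hS : ∀ w', toLex w < toLex w' → Inc c w' → altElt c w' ∈ S) {f : TP n m}
    (hf : f ∈ altSub n c) (hsupp : ∀ w', toLex w' ≤ toLex w → f w' = 0) : f ∈ S := by
  let U : Submodule ℂ (TP n m) :=
    altSub n c ⊓ ⨅ (w') (_ : toLex w' ≤ toLex w), LinearMap.ker (LinearMap.proj w')
  have hU : ∀ x, x ∈ U ↔ x ∈ altSub n c ∧ ∀ w', toLex w' ≤ toLex w → x w' = 0 := by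
    intro x
    simp [U, Submodule.mem_iInf]
  refine le_of_forall_isLead (U := U) ?_ ((hU f).2 ⟨hf, hsupp⟩)
  intro x hx w' hw'
  rw [hU] at hx
  have hinc := hw'.inc hx.1
  have hlt : toLex w < toLex w' := by
    by_contra h
    exact hw'.1 (hx.2 _ (not_lt.1 h))
  exact ⟨_, (hU _).2 ⟨altElt_mem _ _, fun v hv => hinc.altElt_apply_of_lt (hv.trans_lt hlt)⟩,
    hS _ hlt hinc, hinc.isLead⟩

/-- Two windows on which a word increases jointly refine a colouring along which
the word increases. -/
lemma exists_common_inc {N a b : ℕ} {w : Fin m → Fin n} (ha : Inc (win a (a + N)) w)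
    (hb : Inc (win b (b + N)) w) (hab : a ≤ b) : ∃ c : Fin m → ℕ, Inc c w ∧
      (∀ i j : Fin m, win a (a + N) i = win a (a + N) j → c i = c j) ∧
      (∀ i j : Fin m, win b (b + N) i = win b (b + N) j → c i = c j) := by
  by_cases h : a + N ≤ b
  · refine ⟨win₂ a (a + N) b (b + N), ?_, fun i j hij => (win₂_eq_iff h).2 (Or.inl hij),
      fun i j hij => (win₂_eq_iff h).2 (Or.inr hij)⟩
    intro i j hij hc
    rcases (win₂_eq_iff h).1 hc with hc | hc
    · exact ha i j hij hc
    · exact hb i j hij hc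
  · exact ⟨win a (b + N), ha.union hb hab (by omega) (by omega),
      win_eq_of_le le_rfl (by omega), win_eq_of_le hab le_rfl⟩

/-- The leading word of an element of the ideal has an increasing window of length `N`. -/
lemma exists_inc_of_mem_idealW {N k : ℕ} {f : TP n m} (hf : f ∈ idealW n N m k)
    {w : Fin m → Fin n} (hw : IsLead f w) : ∃ a, a + N ≤ k ∧ Inc (win a (a + N)) w := by
  let Red := {w : Fin m → Fin n // ∃ a, a + N ≤ k ∧ Inc (win a (a + N)) w}
  have : Fintype Red := Fintype.ofFinite _
  let pos : Red → ℕ := fun r => r.2.choose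
  have hpos : ∀ r : Red, Inc (win (pos r) (pos r + N)) r.1 := fun r => r.2.choose_spec.2
  let g : Red → TP n m := fun r => altElt (win (pos r) (pos r + N)) r.1
  let S := Submodule.span ℂ (Set.range g)
  have hS : ∀ v : Lex (Fin m → Fin n), ∀ a, a + N ≤ k → Inc (win a (a + N)) (ofLex v) →
      altElt (win a (a + N)) (ofLex v) ∈ S := by
    intro v
    induction v using WellFoundedGT.induction with
    | ind v ih =>
      intro a hak ha
      let r : Red := ⟨ofLex v, a, hak, ha⟩
      have hr := hpos r
      have hposk : pos r + N ≤ k := r.2.choose_spec.1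
      obtain ⟨c, hc, h1, h2⟩ : ∃ c : Fin m → ℕ, Inc c (ofLex v) ∧
          (∀ i j : Fin m, win a (a + N) i = win a (a + N) j → c i = c j) ∧
          (∀ i j : Fin m, win (pos r) (pos r + N) i = win (pos r) (pos r + N) j →
            c i = c j) := by
        rcases le_total a (pos r) with hle | hle
        · exact exists_common_inc ha hr hle
        · obtain ⟨c, hc, h1, h2⟩ := exists_common_inc hr ha hle
          exact ⟨c, hc, h2, h1⟩
      have diff : ∀ b, b + N ≤ k → Inc (win b (b + N)) (ofLex v) →
          (∀ i j : Fin m, win b (b + N) i = win b (b + N) j → c i = c j) →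
          altElt (win b (b + N)) (ofLex v) - altElt c (ofLex v) ∈ S := by
        intro b hbk hb hbc
        refine mem_of_altElt_mem (c := win b (b + N)) (w := ofLex v)
          (fun w' hlt hinc => ih (toLex w') hlt b hbk hinc)
          (Submodule.sub_mem _ (altElt_mem _ _) (altSub_mono hbc (altElt_mem _ _))) ?_
        intro w' hle
        rcases hle.eq_or_lt with heq | hlt
        · obtain rfl : w' = ofLex v := heq
          exact sub_eq_zero.2 (hb.altElt_apply_self.trans hc.altElt_apply_self.symm)
        · simp [hb.altElt_apply_of_lt hlt, hc.altElt_apply_of_lt hlt]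
      have e := S.add_mem (S.sub_mem (diff a hak ha h1) (diff _ hposk hr h2))
        (Submodule.subset_span ⟨r, rfl⟩ : g r ∈ S)
      have e' : altElt (win a (a + N)) (ofLex v) =
          altElt (win a (a + N)) (ofLex v) - altElt c (ofLex v) -
          (altElt (win (pos r) (pos r + N)) (ofLex v) - altElt c (ofLex v)) + g r := by
        simp only [g, r]
        abel
      rw [e']
      exact e
  have hle : idealW n N m k ≤ S := by
    refine iSup₂_le fun a hak => le_of_forall_isLead fun x hx w' hw' => ?_
    have hinc := hw'.inc hx
    exact ⟨_, altElt_mem _ _, hS (toLex w') a hak hinc, hinc.isLead⟩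
  obtain ⟨c, hc⟩ := (Submodule.mem_span_range_iff_exists_fun ℂ).1 (hle hf)
  have hne : ∃ r : Red, c r ≠ 0 := by
    by_contra! h
    apply hw.1
    rw [← hc]
    simp [h]
  obtain ⟨r, hr, hmin⟩ := (Set.toFinite {r : Red | c r ≠ 0}).exists_minimalFor
    (fun r => toLex r.1) _ hne
  have hval : ∀ w', f w' = ∑ r, c r * g r w' := by
    intro w'
    rw [← hc]
    simp [Finset.sum_apply]
  have hlead : IsLead f r.1 := by
    constructor
    · rw [hval, Finset.sum_eq_single r]
      · simpa [g, (hpos r).altElt_apply_self] using hr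
      · intro q _ hq
        by_cases h0 : c q = 0
        · simp [h0]
        rcases lt_or_ge (toLex r.1) (toLex q.1) with hlt | hge
        · simp [g, (hpos q).altElt_apply_of_lt hlt]
        · exact absurd (Subtype.ext (toLex_inj.1 (le_antisymm hge (hmin h0 hge)))) hq
      · simp
    · intro w' hlt
      rw [hval]
      refine Finset.sum_eq_zero fun q _ => ?_
      by_cases h0 : c q = 0
      · simp [h0]
      rcases lt_or_ge (toLex q.1) (toLex r.1) with h | h
      · exact absurd (hmin h0 h.le) (not_le.2 h)
      · simp [g, (hpos q).altElt_apply_of_lt (hlt.trans_le h)]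
  rw [hw.eq hlead]
  exact r.2

/-- Exactness of the Koszul complex, expressed inside `V^{⊗m}`. -/
lemma inf_idealW_le {N k s t : ℕ} (hst : s + t = N) (ht : 1 ≤ t) :
    altSub n (win (m := m) k m) ⊓ idealW n N m (k + s) ≤
      (⨆ _ : t ≤ k, altSub n (win (m := m) (k - t) m)) ⊔ idealW n N m k := by
  refine le_of_forall_isLead fun x hx w hw => ?_
  have hinc := hw.inc hx.1
  obtain ⟨a, hak, ha⟩ := exists_inc_of_mem_idealW hx.2 hw
  by_cases h : a + N ≤ k
  · have hc : Inc (win₂ a (a + N) k m) w := by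
      intro i j hij hc
      rcases (win₂_eq_iff h).1 hc with hc | hc
      · exact ha i j hij hc
      · exact hinc i j hij hc
    have hmem := altElt_mem (win₂ a (a + N) k m) w
    have h1 : altElt (win₂ a (a + N) k m) w ∈ altSub n (win (m := m) a (a + N)) :=
      altSub_mono (fun i j hij => (win₂_eq_iff h).2 (Or.inl hij)) hmem
    exact ⟨_, ⟨altSub_mono (fun i j hij => (win₂_eq_iff h).2 (Or.inr hij)) hmem,
      altSub_le_idealW hak h1⟩, Submodule.mem_sup_right (altSub_le_idealW h h1), hc.isLead⟩
  · have hu : Inc (win (k - t) m) w := by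
      rcases le_or_gt (a + N) m with ham | ham
      · exact (ha.union hinc (by omega) (by omega) ham).mono
          (win_eq_of_le (by omega) le_rfl)
      · exact ha.mono (win_eq_of_le (by omega) ham.le)
    have hmem := altElt_mem (win (k - t) m) w
    refine ⟨_, ⟨altSub_mono (win_eq_of_le (by omega) le_rfl) hmem,
      altSub_le_idealW (a := k - t) (by omega) (altSub_mono ?_ hmem)⟩,
      Submodule.mem_sup_left ?_, hu.isLead⟩
    · intro i j hij
      rw [win_eq_iff] at *
      omega
    · have htk : t ≤ k := by omega
      rwa [iSup_pos htk]

end Groebner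

section Identification

variable {n : ℕ}

lemma antisymR_eq (n N : ℕ) : antisymR n N = altSub n (fun _ => 0) := by
  have hgen : ∀ g : Fin N → Fin n, (∑ σ : Equiv.Perm (Fin N), (Equiv.Perm.sign σ : ℤ) •
      fun u : Fin N → Fin n => if u = g ∘ σ then (1 : ℂ) else 0) =
      altElt (fun _ => 0) g := by
    intro g
    simp [altElt]
  apply le_antisymm
  · refine Submodule.span_le.2 ?_
    rintro f ⟨g, -, rfl⟩
    rw [hgen]
    exact altElt_mem _ _
  · refine le_of_forall_isLead fun x hx w hw => ?_
    have hinc := hw.inc hx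
    exact ⟨_, altElt_mem _ _, Submodule.subset_span
      ⟨w, fun i j hij => hinc i j hij rfl, (hgen w).symm⟩, hinc.isLead⟩

lemma append_comp_swap_left {α : Type*} {a b : ℕ} (p : Fin a → α) (s : Fin b → α)
    (i j : Fin a) : Fin.append (p ∘ Equiv.swap i j) s =
      Fin.append p s ∘ Equiv.swap (Fin.castAdd b i) (Fin.castAdd b j) := by
  funext y
  refine Fin.addCases (fun y => ?_) (fun y => ?_) y
  · simp only [Fin.append_left, Function.comp_apply,
      ← (Fin.castAdd_injective a b).map_swap]
  · have h : ∀ z : Fin a, Fin.natAdd a y ≠ Fin.castAdd b z := fun z h => by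
      have := congrArg Fin.val h
      simp only [Fin.val_natAdd, Fin.val_castAdd] at this
      omega
    simp [Equiv.swap_apply_of_ne_of_ne (h i) (h j)]

lemma append_comp_swap_right {α : Type*} {a b : ℕ} (p : Fin a → α) (s : Fin b → α)
    (i j : Fin b) : Fin.append p (s ∘ Equiv.swap i j) =
      Fin.append p s ∘ Equiv.swap (Fin.natAdd a i) (Fin.natAdd a j) := by
  funext y
  refine Fin.addCases (fun y => ?_) (fun y => ?_) y
  · have h : ∀ z : Fin b, Fin.castAdd b y ≠ Fin.natAdd a z := fun z h => by
      have := congrArg Fin.val h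
      simp only [Fin.val_natAdd, Fin.val_castAdd] at this
      omega
    simp [Equiv.swap_apply_of_ne_of_ne (h i) (h j)]
  · simp only [Fin.append_right, Function.comp_apply,
      ← (Fin.natAdd_injective b a).map_swap]

lemma midSub_eq {N a b m : ℕ} (h : a + N + b = m) :
    midSub n N (antisymR n N) h = altSub n (win a (a + N)) := by
  subst h
  ext f
  simp only [midSub, Submodule.mem_iInf, Submodule.mem_comap, antisymR_eq]
  constructor
  · intro H i j hij hc w
    rw [win_eq_iff] at hc
    obtain ⟨i', rfl⟩ : ∃ i' : Fin N, Fin.castAdd b (Fin.natAdd a i') = i :=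
      ⟨⟨i - a, by omega⟩, Fin.ext (by simp; omega)⟩
    obtain ⟨j', rfl⟩ : ∃ j' : Fin N, Fin.castAdd b (Fin.natAdd a j') = j :=
      ⟨⟨j - a, by omega⟩, Fin.ext (by simp; omega)⟩
    have hij' : i' ≠ j' := fun h => hij (by rw [h])
    obtain ⟨v, s, rfl⟩ : ∃ (v : Fin (a + N) → Fin n) (s : Fin b → Fin n),
        w = Fin.append v s := ⟨_, _, (Fin.append_castAdd_natAdd).symm⟩
    obtain ⟨p, u, rfl⟩ : ∃ (p : Fin a → Fin n) (u : Fin N → Fin n),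
        v = Fin.append p u := ⟨_, _, (Fin.append_castAdd_natAdd).symm⟩
    have := H p s i' j' hij' rfl u
    rw [← append_comp_swap_left, ← append_comp_swap_right]
    exact this
  · intro hf p s i j hij _ u
    have := hf (Fin.castAdd b (Fin.natAdd a i)) (Fin.castAdd b (Fin.natAdd a j))
      (fun h => hij (by simpa using h)) (win_eq_iff.2 (by simp))
      (Fin.append (Fin.append p u) s)
    rw [← append_comp_swap_left, ← append_comp_swap_right] at this
    exact this

lemma idealSub_eq (n N k : ℕ) : idealSub n N (antisymR n N) k = idealW n N k k := by
  apply le_antisymm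
  · refine iSup₂_le fun ab h => ?_
    rw [midSub_eq]
    exact altSub_le_idealW (by omega)
  · refine iSup₂_le fun a h => ?_
    have h' : a + N + (k - (a + N)) = k := by omega
    rw [← midSub_eq h']
    exact le_iSup₂_of_le (a, k - (a + N)) h' le_rfl

lemma Wcomp_eq {N l : ℕ} (hN : 2 ≤ N) (hl : l ≤ 1 ∨ N ≤ l) :
    Wcomp n N (antisymR n N) l = altSub n (win 0 l) := by
  ext f
  simp only [Wcomp, Submodule.mem_iInf, midSub_eq]
  constructor
  · intro H
    rcases hl with hl | hl
    · intro i j hij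
      exact absurd (Fin.ext (by omega)) hij
    · have hwin : ∀ a, a + N ≤ l → f ∈ altSub n (win a (a + N)) :=
        fun a ha => H (a, l - (a + N)) (by simp only; omega)
      have : ∀ r, N + r ≤ l → f ∈ altSub n (win 0 (N + r)) := by
        intro r
        induction r with
        | zero => intro hr; simpa using hwin 0 (by omega)
        | succ r ih =>
          intro hr
          have h1 := hwin (r + 1) (by omega)
          rw [add_comm (r + 1) N] at h1
          exact altSub_union (ih (by omega)) h1 (by omega) (by omega) (by omega)
      obtain ⟨r, rfl⟩ := Nat.exists_eq_add_of_le hl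
      exact this r le_rfl
  · intro hf ab h
    exact altSub_mono (win_eq_of_le (by omega) (by omega)) hf

/-- The slice of a tensor of degree `k + l` with fixed suffix `s` of length `l`. -/
noncomputable def suffixSlice {k l m : ℕ} (h : k + l = m) (s : Fin l → Fin n) :
    TP n m →ₗ[ℂ] TP n k :=
  LinearMap.funLeft ℂ ℂ fun p => Fin.append p s ∘ Fin.cast h.symm

/-- The slice of a tensor of degree `k + l` with fixed prefix `p` of length `k`. -/
noncomputable def prefixSlice {k l m : ℕ} (h : k + l = m) (p : Fin k → Fin n) :
    TP n m →ₗ[ℂ] TP n l :=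
  LinearMap.funLeft ℂ ℂ fun s => Fin.append p s ∘ Fin.cast h.symm

/-- The concatenation product as a bilinear map. -/
noncomputable def mulTₗ (n : ℕ) {k l m : ℕ} (h : k + l = m) :
    TP n k →ₗ[ℂ] TP n l →ₗ[ℂ] TP n m :=
  LinearMap.mk₂ ℂ (mulT h) (fun _ _ _ => by funext w; simp [mulT, add_mul])
    (fun _ _ _ => by funext w; simp [mulT, mul_assoc])
    (fun _ _ _ => by funext w; simp [mulT, mul_add])
    (fun _ _ _ => by funext w; simp [mulT, mul_left_comm])

@[simp] lemma mulTₗ_apply {k l m : ℕ} (h : k + l = m) (f : TP n k) (g : TP n l) :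
    mulTₗ n h f g = mulT h f g := rfl

lemma suffixSlice_mulT {k l m : ℕ} (h : k + l = m) (s : Fin l → Fin n) (f : TP n k)
    (g : TP n l) : suffixSlice h s (mulT h f g) = g s • f := by
  subst h
  funext p
  simp [suffixSlice, mulT, LinearMap.funLeft_apply, mul_comm]

lemma mulT_assoc {a b c d e m : ℕ} (h₁ : a + b = d) (h₂ : d + c = m) (h₃ : b + c = e)
    (h₄ : a + e = m) (f : TP n a) (g : TP n b) (k : TP n c) :
    mulT h₂ (mulT h₁ f g) k = mulT h₄ f (mulT h₃ g k) := by
  subst h₁ h₂ h₃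
  funext w
  simp only [mulT, mul_assoc]
  congr 1
  congr 2
  funext i
  congr 1
  ext
  simp [add_assoc]

lemma sum_mulT_prefixSlice {k l m : ℕ} (h : k + l = m) (x : TP n m) :
    ∑ p, mulT h (Pi.single p 1) (prefixSlice h p x) = x := by
  subst h
  funext w
  rw [Finset.sum_apply, Finset.sum_eq_single (fun i => w (Fin.castAdd l i))]
  · simp only [mulT, prefixSlice, LinearMap.funLeft_apply, Fin.cast_eq_self,
      Pi.single_eq_same, one_mul]
    exact congrArg x Fin.append_castAdd_natAdd
  · intro p _ hp
    simp [mulT, hp.symm]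
  · simp

lemma sum_mulT_suffixSlice {k l m : ℕ} (h : k + l = m) (x : TP n m) :
    ∑ s, mulT h (suffixSlice h s x) (Pi.single s 1) = x := by
  subst h
  funext w
  rw [Finset.sum_apply, Finset.sum_eq_single (fun i => w (Fin.natAdd k i))]
  · simp only [mulT, suffixSlice, LinearMap.funLeft_apply, Fin.cast_eq_self,
      Pi.single_eq_same, mul_one]
    exact congrArg x Fin.append_castAdd_natAdd
  · intro p _ hp
    simp [mulT, hp.symm]
  · simp

lemma prefixSlice_mem {k l m : ℕ} (h : k + l = m) (p : Fin k → Fin n) {x : TP n m}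
    (hx : x ∈ altSub n (win k m)) : prefixSlice h p x ∈ altSub n (win 0 l) := by
  subst h
  intro i j hij _ s
  have := hx (Fin.natAdd k i) (Fin.natAdd k j) (fun h => hij (by simpa using h))
    (win_eq_iff.2 (by simp)) (Fin.append p s)
  rwa [← append_comp_swap_right] at this

lemma suffixSlice_mem {k l m a b : ℕ} (h : k + l = m) (s : Fin l → Fin n) {x : TP n m}
    (hx : x ∈ altSub n (win a b)) : suffixSlice h s x ∈ altSub n (win a b) := by
  subst h
  intro i j hij hc p
  have := hx (Fin.castAdd l i) (Fin.castAdd l j) (fun h => hij (by simpa using h))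
    hc (Fin.append p s)
  rwa [← append_comp_swap_left] at this

lemma mulT_mem_right {k l m : ℕ} (h : k + l = m) (f : TP n k) {g : TP n l}
    (hg : g ∈ altSub n (win 0 l)) : mulT h f g ∈ altSub n (win k m) := by
  subst h
  intro i j hij hc w
  rw [win_eq_iff] at hc
  obtain ⟨i', rfl⟩ : ∃ i' : Fin l, Fin.natAdd k i' = i :=
    ⟨⟨i - k, by omega⟩, Fin.ext (by simp; omega)⟩
  obtain ⟨j', rfl⟩ : ∃ j' : Fin l, Fin.natAdd k j' = j :=
    ⟨⟨j - k, by omega⟩, Fin.ext (by simp; omega)⟩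
  have hij' : i' ≠ j' := fun h => hij (by rw [h])
  obtain ⟨p, s, rfl⟩ : ∃ (p : Fin k → Fin n) (s : Fin l → Fin n),
      w = Fin.append p s := ⟨_, _, (Fin.append_castAdd_natAdd).symm⟩
  rw [← append_comp_swap_right]
  have := hg i' j' hij' (win_eq_iff.2 (by simp)) s
  simp only [mulT, Fin.cast_eq_self, Fin.append_left, Fin.append_right]
  rw [← mul_neg, ← this]

lemma mulT_mem_left {k l m a b : ℕ} (h : k + l = m) (hb : b ≤ k) {f : TP n k} (g : TP n l)
    (hf : f ∈ altSub n (win a b)) : mulT h f g ∈ altSub n (win a b) := by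
  subst h
  intro i j hij hc w
  rw [win_eq_iff] at hc
  obtain ⟨i', rfl⟩ : ∃ i' : Fin k, Fin.castAdd l i' = i :=
    ⟨⟨i, by omega⟩, Fin.ext (by simp)⟩
  obtain ⟨j', rfl⟩ : ∃ j' : Fin k, Fin.castAdd l j' = j :=
    ⟨⟨j, by omega⟩, Fin.ext (by simp)⟩
  have hij' : i' ≠ j' := fun h => hij (by rw [h])
  obtain ⟨p, s, rfl⟩ : ∃ (p : Fin k → Fin n) (s : Fin l → Fin n),
      w = Fin.append p s := ⟨_, _, (Fin.append_castAdd_natAdd).symm⟩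
  rw [← append_comp_swap_left]
  have := hf i' j' hij' (win_eq_iff.2 (by simpa using hc)) p
  simp only [mulT, Fin.cast_eq_self, Fin.append_left, Fin.append_right]
  rw [← neg_mul, ← this]

lemma mem_idealW_iff {N k l m : ℕ} (h : k + l = m) (x : TP n m) :
    x ∈ idealW n N m k ↔ ∀ s, suffixSlice h s x ∈ idealSub n N (antisymR n N) k := by
  simp only [idealSub_eq]
  constructor
  · intro hx s
    have : idealW n N m k ≤ (idealW n N k k).comap (suffixSlice h s) :=
      iSup₂_le fun a ha y hy => altSub_le_idealW ha (suffixSlice_mem h s hy)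
    exact this hx
  · intro hx
    rw [← sum_mulT_suffixSlice h x]
    refine Submodule.sum_mem _ fun s _ => ?_
    have : idealW n N k k ≤ (idealW n N m k).comap ((mulTₗ n h).flip (Pi.single s 1)) :=
      iSup₂_le fun a ha y hy => altSub_le_idealW ha (mulT_mem_left h ha _ hy)
    exact this (hx s)

end Identification

section Koszul

variable {n : ℕ}

/-- The canonical map `A_k ⊗ W_l → A_k ⊗ V^{⊗l}`, the target being realized as functions
on words of length `l`. -/
noncomputable def coeffMap (n N k l : ℕ) :
    (Acomp n N (antisymR n N) k ⊗[ℂ] Wcomp n N (antisymR n N) l) →ₗ[ℂ]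
      ((Fin l → Fin n) → Acomp n N (antisymR n N) k) :=
  TensorProduct.piScalarRightHom ℂ ℂ _ _ ∘ₗ
    (Wcomp n N (antisymR n N) l).subtype.lTensor _

lemma coeffMap_injective (n N k l : ℕ) : Function.Injective (coeffMap n N k l) := by
  have h1 : Function.Injective
      (TensorProduct.piScalarRight ℂ ℂ (Acomp n N (antisymR n N) k) (Fin l → Fin n)) :=
    LinearEquiv.injective _
  exact h1.comp (Module.Flat.lTensor_preserves_injective_linearMap _
    (Submodule.injective_subtype _))

/-- The quotient map `V^{⊗k} ⊗ W_l → A_k ⊗ W_l`. -/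
noncomputable def quotMap (n N k l : ℕ) :
    (TP n k ⊗[ℂ] Wcomp n N (antisymR n N) l) →ₗ[ℂ]
      (Acomp n N (antisymR n N) k ⊗[ℂ] Wcomp n N (antisymR n N) l) :=
  (idealSub n N (antisymR n N) k).mkQ.rTensor _

lemma quotMap_surjective (n N k l : ℕ) : Function.Surjective (quotMap n N k l) :=
  LinearMap.rTensor_surjective _ (Submodule.mkQ_surjective _)

/-- The concatenation map `V^{⊗k} ⊗ W_l → V^{⊗m}`. -/
noncomputable def concatMap (n N : ℕ) {k l m : ℕ} (h : k + l = m) :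
    (TP n k ⊗[ℂ] Wcomp n N (antisymR n N) l) →ₗ[ℂ] TP n m :=
  TensorProduct.lift ((mulTₗ n h).compl₂ (Wcomp n N (antisymR n N) l).subtype)

lemma concatMap_tmul {N k l m : ℕ} (h : k + l = m) (u : TP n k)
    (w : Wcomp n N (antisymR n N) l) :
    concatMap n N h (u ⊗ₜ w) = mulT h u (w : TP n l) := rfl

lemma coeffMap_quotMap {N k l m : ℕ} (h : k + l = m)
    (y : TP n k ⊗[ℂ] Wcomp n N (antisymR n N) l) (s : Fin l → Fin n) :
    coeffMap n N k l (quotMap n N k l y) s =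
      (idealSub n N (antisymR n N) k).mkQ (suffixSlice h s (concatMap n N h y)) := by
  induction y with
  | zero => simp
  | add y z hy hz => simp only [map_add, Pi.add_apply, hy, hz]
  | tmul u w =>
    rw [concatMap_tmul, suffixSlice_mulT, map_smul]
    simp [coeffMap, quotMap]

/-- An element of `A_k ⊗ W_l` vanishes iff its lift lies in `I_k ⊗ V^{⊗l}`. -/
lemma quotMap_eq_zero_iff {N k l m : ℕ} (h : k + l = m)
    (y : TP n k ⊗[ℂ] Wcomp n N (antisymR n N) l) :
    quotMap n N k l y = 0 ↔ concatMap n N h y ∈ idealW n N m k := by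
  rw [mem_idealW_iff h, ← (coeffMap_injective n N k l).eq_iff, map_zero, funext_iff]
  refine forall_congr' fun s => ?_
  rw [coeffMap_quotMap h, Pi.zero_apply, Submodule.mkQ_apply, Submodule.Quotient.mk_eq_zero]

lemma quotMap_eq_iff {N k l m : ℕ} (h : k + l = m)
    (y z : TP n k ⊗[ℂ] Wcomp n N (antisymR n N) l) :
    quotMap n N k l y = quotMap n N k l z ↔
      concatMap n N h y - concatMap n N h z ∈ idealW n N m k := by
  rw [← sub_eq_zero, ← map_sub, quotMap_eq_zero_iff h, map_sub]

lemma exists_concatMap_eq {N k l m : ℕ} (hN : 2 ≤ N) (hl : l ≤ 1 ∨ N ≤ l) (h : k + l = m)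
    {x : TP n m} (hx : x ∈ altSub n (win k m)) : ∃ y, concatMap n N h y = x := by
  refine ⟨∑ p, Pi.single p 1 ⊗ₜ ⟨prefixSlice h p x, ?_⟩, ?_⟩
  · rw [Wcomp_eq hN hl]
    exact prefixSlice_mem h p hx
  · simp only [map_sum, concatMap_tmul, sum_mulT_prefixSlice]

lemma concatMap_mem {N k l m : ℕ} (hN : 2 ≤ N) (hl : l ≤ 1 ∨ N ≤ l) (h : k + l = m)
    (y : TP n k ⊗[ℂ] Wcomp n N (antisymR n N) l) :
    concatMap n N h y ∈ altSub n (win k m) := by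
  induction y with
  | zero => simp
  | add y z hy hz => rw [map_add]; exact Submodule.add_mem _ hy hz
  | tmul u w =>
    rw [concatMap_tmul]
    refine mulT_mem_right h u ?_
    rw [← Wcomp_eq hN hl]
    exact w.2

lemma nuN_le_one_or_le {N : ℕ} (ℓ : ℕ) : nuN N ℓ ≤ 1 ∨ N ≤ nuN N ℓ := by
  unfold nuN
  rcases Nat.eq_zero_or_pos (ℓ / 2) with h | h
  · left
    rw [h]
    omega
  · right
    calc N = N * 1 := (mul_one N).symm
      _ ≤ N * (ℓ / 2) := Nat.mul_le_mul_left N h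
      _ ≤ _ := Nat.le_add_right _ _

lemma nuN_add_two (N ℓ : ℕ) : nuN N (ℓ + 2) = nuN N ℓ + N := by
  unfold nuN
  rw [Nat.add_div_right _ two_pos, Nat.add_mod_right, mul_add]
  ring

lemma nuN_lt_succ {N : ℕ} (hN : 2 ≤ N) (ℓ : ℕ) : nuN N ℓ < nuN N (ℓ + 1) := by
  unfold nuN
  rcases Nat.even_or_odd' ℓ with ⟨c, rfl | rfl⟩
  · rw [show (2 * c + 1) / 2 = c by omega, show (2 * c) / 2 = c by omega]
    omega
  · rw [show (2 * c + 1 + 1) / 2 = c + 1 by omega, show (2 * c + 1) / 2 = c by omega, mul_add]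
    omega

/-- The Koszul differential is induced by the inclusion of `V^{⊗k} ⊗ W_{ν(ℓ+1)}` into
`V^{⊗(k+s)} ⊗ W_{ν(ℓ)}`. -/
lemma KoszulDiff.map_quotMap {N m : ℕ} (hN : 2 ≤ N)
    {d : ∀ ℓ : ℕ,
      (Acomp n N (antisymR n N) (m - nuN N (ℓ+1)) ⊗[ℂ]
        Wcomp n N (antisymR n N) (nuN N (ℓ+1))) →ₗ[ℂ]
      (Acomp n N (antisymR n N) (m - nuN N ℓ) ⊗[ℂ]
        Wcomp n N (antisymR n N) (nuN N ℓ))}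
    (hd : KoszulDiff n N (antisymR n N) m d) {ℓ : ℕ} (h₁ : m - nuN N (ℓ+1) + nuN N (ℓ+1) = m)
    (h₀ : m - nuN N ℓ + nuN N ℓ = m)
    (y : TP n (m - nuN N (ℓ+1)) ⊗[ℂ] Wcomp n N (antisymR n N) (nuN N (ℓ+1)))
    (z : TP n (m - nuN N ℓ) ⊗[ℂ] Wcomp n N (antisymR n N) (nuN N ℓ))
    (hyz : concatMap n N h₁ y = concatMap n N h₀ z) :
    d ℓ (quotMap n N _ _ y) = quotMap n N _ _ z := by
  have hlt := nuN_lt_succ hN ℓ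
  have key : ∀ y, ∃ z, concatMap n N h₁ y = concatMap n N h₀ z ∧
      d ℓ (quotMap n N _ _ y) = quotMap n N _ _ z := by
    intro y
    induction y with
    | zero => exact ⟨0, by simp⟩
    | add y y' hy hy' =>
      obtain ⟨z, hz, hz'⟩ := hy
      obtain ⟨w, hw, hw'⟩ := hy'
      exact ⟨z + w, by simp only [map_add, hz, hw], by simp only [map_add, hz', hw']⟩
    | tmul u w =>
      have hs : (nuN N (ℓ+1) - nuN N ℓ) + nuN N ℓ = nuN N (ℓ+1) := by omega
      have hk : (m - nuN N (ℓ+1)) + (nuN N (ℓ+1) - nuN N ℓ) = m - nuN N ℓ := by omega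
      have hw : (w : TP n (nuN N (ℓ+1))) ∈ altSub n (win 0 (nuN N (ℓ+1))) := by
        rw [← Wcomp_eq hN (nuN_le_one_or_le _)]
        exact w.2
      have hmem : ∀ p, prefixSlice hs p (w : TP n (nuN N (ℓ+1))) ∈
          Wcomp n N (antisymR n N) (nuN N ℓ) := by
        intro p
        rw [Wcomp_eq hN (nuN_le_one_or_le _)]
        exact prefixSlice_mem hs p (altSub_mono (win_eq_of_le (by omega) le_rfl) hw)
      let e := (Fintype.equivFin (Fin (nuN N (ℓ+1) - nuN N ℓ) → Fin n)).symm
      let v : Fin _ → TP n (nuN N (ℓ+1) - nuN N ℓ) := fun i => Pi.single (e i) 1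
      let w' : Fin _ → Wcomp n N (antisymR n N) (nuN N ℓ) := fun i => ⟨_, hmem (e i)⟩
      have hdec : (w : TP n (nuN N (ℓ+1))) = ∑ i, mulT hs (v i) (w' i) := by
        rw [e.sum_comp (fun p => mulT hs (Pi.single p 1)
          (prefixSlice hs p (w : TP n (nuN N (ℓ+1))))), sum_mulT_prefixSlice]
      refine ⟨∑ i, mulT hk u (v i) ⊗ₜ w' i, ?_, ?_⟩
      · simp only [map_sum, concatMap_tmul, mulT_assoc hk h₀ hs h₁]
        rw [hdec, ← mulTₗ_apply, map_sum]
        rfl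
      · have := hd ℓ (by omega) hs hk u w _ v w' hdec
        simp only [map_sum]
        exact this
  obtain ⟨z', hz, hz'⟩ := key y
  rw [hz', quotMap_eq_iff h₀, ← hz, hyz, sub_self]
  exact Submodule.zero_mem _

/-- A cycle of the Koszul complex differs by an element of `I_k ⊗ V^{⊗l}` from an
element of `V^{⊗(k-t)} ⊗ W_{l+t}`, where `l = ν(ℓ+1)` and `l + t = ν(ℓ+2)`. -/
lemma KoszulDiff.exists_of_mem_ker {N m : ℕ} (hN : 2 ≤ N)
    {d : ∀ ℓ : ℕ,
      (Acomp n N (antisymR n N) (m - nuN N (ℓ+1)) ⊗[ℂ]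
        Wcomp n N (antisymR n N) (nuN N (ℓ+1))) →ₗ[ℂ]
      (Acomp n N (antisymR n N) (m - nuN N ℓ) ⊗[ℂ]
        Wcomp n N (antisymR n N) (nuN N ℓ))}
    (hd : KoszulDiff n N (antisymR n N) m d) {ℓ : ℕ} (h₁ : m - nuN N (ℓ+1) + nuN N (ℓ+1) = m)
    {y : TP n (m - nuN N (ℓ+1)) ⊗[ℂ] Wcomp n N (antisymR n N) (nuN N (ℓ+1))}
    (hy : d ℓ (quotMap n N _ _ y) = 0) :
    ∃ x, concatMap n N h₁ y - x ∈ idealW n N m (m - nuN N (ℓ+1)) ∧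
      x ∈ ⨆ _ : nuN N (ℓ+2) ≤ m, altSub n (win (m := m) (m - nuN N (ℓ+2)) m) := by
  have hlt := nuN_lt_succ hN ℓ
  have hlt' : nuN N (ℓ+1) < nuN N (ℓ+2) := nuN_lt_succ hN (ℓ+1)
  have h2 := nuN_add_two N ℓ
  have h₀ : m - nuN N ℓ + nuN N ℓ = m := by omega
  have hmem := concatMap_mem hN (nuN_le_one_or_le _) h₁ y
  obtain ⟨z, hz⟩ := exists_concatMap_eq hN (nuN_le_one_or_le ℓ) h₀
    (altSub_mono (win_eq_of_le (by omega) le_rfl) hmem)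
  rw [hd.map_quotMap hN h₁ h₀ y z hz.symm, quotMap_eq_zero_iff h₀, hz] at hy
  have hU := inf_idealW_le (n := n) (m := m) (N := N) (k := m - nuN N (ℓ+1))
    (s := nuN N (ℓ+1) - nuN N ℓ) (t := nuN N (ℓ+2) - nuN N (ℓ+1)) (by omega) (by omega)
  have hks : m - nuN N (ℓ+1) + (nuN N (ℓ+1) - nuN N ℓ) = m - nuN N ℓ := by omega
  rw [hks] at hU
  obtain ⟨x, hx, x', hx', hsum⟩ := Submodule.mem_sup.1 (hU ⟨hmem, hy⟩)
  refine ⟨x, ?_, ?_⟩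
  · rw [← hsum, add_sub_cancel_left]
    exact hx'
  · refine SetLike.le_def.1 (iSup_le fun htk => le_iSup_of_le (by omega) (le_of_eq ?_)) hx
    rw [show m - nuN N (ℓ+1) - (nuN N (ℓ+2) - nuN N (ℓ+1)) = m - nuN N (ℓ+2) by omega]

end Koszul

/-- **The `N`-antisymmetrizer algebra is `N`-Koszul** (Berger).  For `2 ≤ N ≤ n`, let
`R ⊆ (ℂ^n)^{⊗N}` be the span of the antisymmetric tensors of degree `N`.  Then for every
`m ≥ 1` the total-degree-`m` part `K(A)_m` of the Koszul complex of `A = A(V,R)` is exact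
at every position `ℓ ≥ 1`: `ker = range` at the interior positions, and the differential
leaving the top position (the largest `ℓ` with `ν_N(ℓ) ≤ m`, where the incoming term of
`K(A)_m` vanishes) is injective. -/
theorem antisymmetrizer_is_N_Koszul (n N : ℕ) (hN : 2 ≤ N) (hn : N ≤ n)
    (m : ℕ) (hm : 1 ≤ m)
    (d : ∀ ℓ : ℕ,
      (Acomp n N (antisymR n N) (m - nuN N (ℓ+1)) ⊗[ℂ]
        Wcomp n N (antisymR n N) (nuN N (ℓ+1))) →ₗ[ℂ]
      (Acomp n N (antisymR n N) (m - nuN N ℓ) ⊗[ℂ]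
        Wcomp n N (antisymR n N) (nuN N ℓ)))
    (hd : KoszulDiff n N (antisymR n N) m d) :
    (∀ ℓ : ℕ, nuN N (ℓ+2) ≤ m →
      LinearMap.ker (d ℓ) = LinearMap.range (d (ℓ+1))) ∧
    (∀ ℓ : ℕ, nuN N (ℓ+1) ≤ m → m < nuN N (ℓ+2) →
      LinearMap.ker (d ℓ) = ⊥) := by
  constructor
  · intro ℓ hℓ
    have hlt := nuN_lt_succ hN ℓ
    have hlt' : nuN N (ℓ+1) < nuN N (ℓ+2) := nuN_lt_succ hN (ℓ+1)
    have h2 := nuN_add_two N ℓ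
    have h₀ : m - nuN N ℓ + nuN N ℓ = m := by omega
    have h₁ : m - nuN N (ℓ+1) + nuN N (ℓ+1) = m := by omega
    have h₂ : m - nuN N (ℓ+2) + nuN N (ℓ+2) = m := by omega
    ext X
    rw [LinearMap.mem_ker, LinearMap.mem_range]
    constructor
    · intro hX
      obtain ⟨y, rfl⟩ := quotMap_surjective n N _ _ X
      obtain ⟨x, hx, hx'⟩ := hd.exists_of_mem_ker hN h₁ hX
      rw [iSup_pos hℓ] at hx'
      obtain ⟨z, hz⟩ := exists_concatMap_eq hN (nuN_le_one_or_le (ℓ+2)) h₂ hx'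
      obtain ⟨y', hy'⟩ := exists_concatMap_eq hN (nuN_le_one_or_le (ℓ+1)) h₁
        (altSub_mono (win_eq_of_le (by omega) le_rfl) hx')
      refine ⟨quotMap n N _ _ z, ?_⟩
      rw [hd.map_quotMap (ℓ := ℓ+1) hN h₂ h₁ z y' (hz.trans hy'.symm), eq_comm,
        quotMap_eq_iff h₁, hy']
      exact hx
    · rintro ⟨Z, rfl⟩
      obtain ⟨z, rfl⟩ := quotMap_surjective n N _ _ Z
      have hmem := concatMap_mem hN (nuN_le_one_or_le (ℓ+2)) h₂ z
      obtain ⟨y, hy⟩ := exists_concatMap_eq hN (nuN_le_one_or_le (ℓ+1)) h₁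
        (altSub_mono (win_eq_of_le (by omega) le_rfl) hmem)
      obtain ⟨x, hx⟩ := exists_concatMap_eq hN (nuN_le_one_or_le ℓ) h₀
        (altSub_mono (win_eq_of_le (by omega) le_rfl) hmem)
      rw [hd.map_quotMap (ℓ := ℓ+1) hN h₂ h₁ z y hy.symm,
        hd.map_quotMap hN h₁ h₀ y x (hy.trans hx.symm), quotMap_eq_zero_iff h₀, hx]
      exact altSub_le_idealW (a := m - nuN N (ℓ+2)) (by omega)
        (altSub_mono (win_eq_of_le le_rfl (by omega)) hmem)
  · intro ℓ hℓ hlt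
    have h₁ : m - nuN N (ℓ+1) + nuN N (ℓ+1) = m := by omega
    rw [eq_bot_iff]
    intro X hX
    obtain ⟨y, rfl⟩ := quotMap_surjective n N _ _ X
    obtain ⟨x, hx, hx'⟩ := hd.exists_of_mem_ker hN h₁ hX
    rw [iSup_neg (not_le.2 hlt), Submodule.mem_bot] at hx'
    rw [hx', sub_zero] at hx
    exact (quotMap_eq_zero_iff h₁ y).2 hx
end

section
/- Let 2 ≤ N ≤ n be integers and let A be the N-antisymmetrizer algebra on n variables. Then the images in A of the admissible monomials x_{i_1} x_{i_2} ⋯ x_{i_k} (over all k ≥ 0 and all admissible words (i_1, …, i_k)) form a ℂ-linear basis of A. -/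
/-- A word with letters in `{1,…,n}` (modeled as `Fin n`) is admissible if it contains
no `N`-descent, i.e. no contiguous strictly decreasing subword of length `N`. -/
def Admissible (n N : ℕ) (l : List (Fin n)) : Prop :=
  ¬ ∃ w : List (Fin n), w.length = N ∧ w.Chain' (· > ·) ∧ w <:+: l

/-- The monomial `x_{i₁} ⋯ x_{i_k}` in the free algebra `ℂ⟨x_1,…,x_n⟩`
associated with the word `(i₁,…,i_k)`. -/
noncomputable def monoF (n : ℕ) (l : List (Fin n)) : FreeAlgebra ℂ (Fin n) :=
  (l.map (FreeAlgebra.ι ℂ)).prod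

/-- The set of antisymmetrizer relations
`∑_{σ ∈ S_N} sgn(σ) x_{i_{σ(1)}} ⋯ x_{i_{σ(N)}}`, `1 ≤ i₁ < ⋯ < i_N ≤ n`. -/
noncomputable def relSet (n N : ℕ) : Set (FreeAlgebra ℂ (Fin n)) :=
  {x | ∃ g : Fin N → Fin n, StrictMono g ∧
    x = ∑ σ : Equiv.Perm (Fin N), (Equiv.Perm.sign σ : ℤ) •
          monoF n (List.ofFn fun j => g (σ j))}

/-- The two-sided ideal generated by the relations, as a `ℂ`-subspace of the
free algebra: the span of all `u · r · v` with `r` a relation. -/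
noncomputable def relIdeal (n N : ℕ) : Submodule ℂ (FreeAlgebra ℂ (Fin n)) :=
  Submodule.span ℂ {y | ∃ u r v : FreeAlgebra ℂ (Fin n), r ∈ relSet n N ∧ y = u * r * v}

section Words

variable {α : Type*} [LinearOrder α]

/-- The words obtained from `w` by permuting letters inside its maximal weakly increasing runs,
described by the multisets of the prefixes of `w` that end at a descent. -/
def RunRearrangement (w u : List α) : Prop :=
  u.Perm w ∧ ∀ q, ∀ h : q + 1 < w.length, w[q + 1] < w[q] →
    (u.take (q + 1)).Perm (w.take (q + 1))

lemma RunRearrangement.refl (w : List α) : RunRearrangement w w :=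
  ⟨List.Perm.refl w, fun _ _ _ => List.Perm.refl _⟩

/-- A word is lexicographically minimal among the rearrangements of its increasing runs. -/
lemma RunRearrangement.le {w u : List α} (h : RunRearrangement w u) : w ≤ u := by
  by_contra hlt
  rw [not_le, List.lt_iff_exists] at hlt
  have hlen := h.1.length_eq
  obtain ⟨-, hl⟩ | ⟨i, hiu, hiw, heq, hlt⟩ := hlt
  · omega
  have htake : u.take i = w.take i :=
    List.ext_getElem (by simp [hlen]) fun j hj _ => by
      simpa using heq j (by simp at hj; omega)
  have no_perm : ∀ p, i < p → p ≤ w.length →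
      (∀ j, ∀ hj : j < w.length, i ≤ j → j < p → w[i] ≤ w[j]) →
      ¬ (u.take p).Perm (w.take p) := by
    intro p hip hpl hle hp
    have split : ∀ v : List α, v.take p = v.take i ++ (v.take p).drop i := fun v => by
      conv_lhs => rw [← List.take_append_drop i (v.take p)]
      rw [List.take_take, min_eq_left hip.le]
    rw [split u, split w, htake, List.perm_append_left_iff] at hp
    have hmem : u[i] ∈ (u.take p).drop i := by
      rw [List.mem_iff_getElem]
      exact ⟨0, by simp; omega, by simp⟩
    obtain ⟨j, hj, hj'⟩ := List.mem_iff_getElem.1 (hp.mem_iff.1 hmem)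
    simp only [List.length_drop, List.length_take] at hj
    have := hle (i + j) (by omega) (by omega) (by omega)
    simp only [List.getElem_drop, List.getElem_take] at hj'
    rw [hj'] at this
    exact absurd hlt (not_lt.2 this)
  have run : ∀ p, i < p → p ≤ w.length →
      ∀ j, ∀ hj : j < w.length, i ≤ j → j < p → w[i] ≤ w[j] := by
    intro p hip
    induction p, hip using Nat.le_induction with
    | base =>
      intro _ j hj h1 h2
      obtain rfl : j = i := by omega
      exact le_rfl
    | succ p hip ih =>
      intro hpl j hj h1 h2
      have ih := ih (by omega)
      by_cases hjp : j < p
      · exact ih j hj h1 hjp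
      obtain rfl : j = p := by omega
      obtain ⟨q, rfl⟩ : ∃ q, j = q + 1 := ⟨j - 1, by omega⟩
      refine (ih q (by omega) (by omega) (by omega)).trans (not_lt.1 fun hd => ?_)
      exact no_perm _ hip (by omega) ih (h.2 q hj hd)
  refine no_perm w.length hiw le_rfl (run _ hiw le_rfl) ?_
  rw [List.take_length, ← hlen, List.take_length]
  exact h.1

lemma take_swap_perm (c d : List α) (x y : α) {p : ℕ} (hp : p ≠ c.length + 1) :
    ((c ++ x :: y :: d).take p).Perm ((c ++ y :: x :: d).take p) := by
  rw [List.take_append, List.take_append]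
  refine List.Perm.append_left _ ?_
  match hm : p - c.length with
  | 0 => simp
  | 1 => omega
  | m + 2 => simpa using List.Perm.swap y x (d.take m)

/-- Swapping two neighbouring letters at a non-descent of `w` preserves membership in the
rearrangement class of `w`. -/
lemma RunRearrangement.swap {w c d : List α} {x y : α} (hc : c.length + 1 < w.length)
    (hw : w[c.length] ≤ w[c.length + 1]) (h : RunRearrangement w (c ++ x :: y :: d)) :
    RunRearrangement w (c ++ y :: x :: d) := by
  refine ⟨((List.Perm.swap x y d).append_left c).trans h.1, fun q hq hd => ?_⟩
  refine (take_swap_perm c d y x fun hqc => ?_).trans (h.2 q hq hd)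
  obtain rfl : q = c.length := by omega
  exact absurd hd (not_lt.2 hw)

/-- A strictly decreasing word is the lexicographically largest arrangement of its letters. -/
lemma append_lt_append_of_perm {d u : List α} (hd : d.Pairwise (· > ·)) (h : u.Perm d)
    (hne : u ≠ d) (b : List α) : u ++ b < d ++ b := by
  induction d generalizing u with
  | nil => exact absurd h.eq_nil hne
  | cons x d ih =>
    obtain _ | ⟨y, u⟩ := u
    · simpa using h.length_eq
    rw [List.pairwise_cons] at hd
    simp only [List.cons_append, List.cons_lt_cons_iff]
    obtain rfl | hy := List.mem_cons.1 (h.mem_iff.1 (List.mem_cons_self (a := y)))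
    · exact Or.inr ⟨rfl, ih hd.2 h.cons_inv fun e => hne (by rw [e])⟩
    · exact Or.inl (hd.1 y hy)

lemma append_lt_append_left (a : List α) {u v : List α} (h : u < v) : a ++ u < a ++ v := by
  induction a with
  | nil => exact h
  | cons x a ih => simpa [List.cons_lt_cons_iff] using ih

end Words

lemma ofFn_eq_append_cons_cons {α : Type*} {N i : ℕ} (h : Fin N → α) (hi : i + 1 < N) :
    List.ofFn h = (List.ofFn h).take i ++
      h ⟨i, by omega⟩ :: h ⟨i + 1, hi⟩ :: (List.ofFn h).drop (i + 2) := by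
  conv_lhs => rw [← List.take_append_drop i (List.ofFn h)]
  rw [List.drop_eq_getElem_cons (by simp; omega), List.drop_eq_getElem_cons (by simp; omega)]
  simp

lemma ofFn_comp_swap {α : Type*} {N i : ℕ} (h : Fin N → α) (hi : i + 1 < N) :
    List.ofFn (fun j => h (Equiv.swap ⟨i, Nat.lt_of_succ_lt hi⟩ ⟨i + 1, hi⟩ j)) =
      (List.ofFn h).take i ++ h ⟨i + 1, hi⟩ :: h ⟨i, by omega⟩ :: (List.ofFn h).drop (i + 2) := by
  rw [ofFn_eq_append_cons_cons
    (fun j => h (Equiv.swap ⟨i, Nat.lt_of_succ_lt hi⟩ ⟨i + 1, hi⟩ j)) hi]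
  simp only [Equiv.swap_apply_left, Equiv.swap_apply_right]
  congr 1
  · refine List.ext_getElem (by simp) fun j hj _ => ?_
    simp only [List.length_take, List.length_ofFn] at hj
    simp only [List.getElem_take, List.getElem_ofFn]
    rw [Equiv.swap_apply_of_ne_of_ne] <;> simp [Fin.ext_iff] <;> omega
  · congr 2
    refine List.ext_getElem (by simp) fun j hj _ => ?_
    simp only [List.getElem_drop, List.getElem_ofFn]
    rw [Equiv.swap_apply_of_ne_of_ne] <;> simp [Fin.ext_iff] <;> omega

section FreeAlgebra

variable {n N : ℕ}

lemma monoF_append (a b : List (Fin n)) : monoF n (a ++ b) = monoF n a * monoF n b := by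
  simp [monoF]

lemma basisFreeMonoid_eq_monoF (l : List (Fin n)) :
    FreeAlgebra.basisFreeMonoid ℂ (Fin n) (FreeMonoid.ofList l) = monoF n l := by
  simp [FreeAlgebra.basisFreeMonoid, monoF, FreeAlgebra.equivMonoidAlgebraFreeMonoid,
    FreeMonoid.lift_apply]

lemma span_range_monoF : Submodule.span ℂ (Set.range (monoF n)) = ⊤ := by
  rw [← (FreeAlgebra.basisFreeMonoid ℂ (Fin n)).span_eq]
  congr 1
  ext x
  constructor
  · rintro ⟨l, rfl⟩
    exact ⟨FreeMonoid.ofList l, basisFreeMonoid_eq_monoF l⟩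
  · rintro ⟨l, rfl⟩
    exact ⟨FreeMonoid.toList l, (basisFreeMonoid_eq_monoF _).symm⟩

open Classical in
/-- The functional on the free algebra which is the indicator function of the rearrangements of
the increasing runs of `w`. -/
noncomputable def runFunctional (w : List (Fin n)) : FreeAlgebra ℂ (Fin n) →ₗ[ℂ] ℂ :=
  (FreeAlgebra.basisFreeMonoid ℂ (Fin n)).constr ℂ
    fun u => if RunRearrangement w (FreeMonoid.toList u) then 1 else 0

open Classical in
lemma runFunctional_monoF (w u : List (Fin n)) :
    runFunctional w (monoF n u) = if RunRearrangement w u then 1 else 0 := by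
  rw [← basisFreeMonoid_eq_monoF, runFunctional, Module.Basis.constr_basis]
  rfl

/-- Among any `N` consecutive positions of an admissible word there is a non-descent. -/
lemma Admissible.exists_le {w : List (Fin n)} (hw : Admissible n N w) {k : ℕ}
    (hk : k + N ≤ w.length) :
    ∃ i, ∃ hi : i + 1 < N, w[k + i] ≤ w[k + i + 1] := by
  by_contra! hcon
  refine hw ⟨(w.drop k).take N, by simp; omega, ?_,
    (List.take_prefix _ _).isInfix.trans (List.drop_suffix _ _).isInfix⟩
  refine List.isChain_iff_getElem.2 fun i hi => ?_
  simp only [List.length_take, List.length_drop] at hi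
  simpa [add_assoc] using hcon i (by omega)

lemma runFunctional_monomial_mul_relation {w : List (Fin n)} (hw : Admissible n N w)
    (g : Fin N → Fin n) (a b : List (Fin n)) :
    runFunctional w (monoF n a * (∑ σ : Equiv.Perm (Fin N), (Equiv.Perm.sign σ : ℤ) •
      monoF n (List.ofFn fun j => g (σ j))) * monoF n b) = 0 := by
  classical
  simp only [Finset.mul_sum, Finset.sum_mul, map_sum, mul_smul_comm, smul_mul_assoc, map_zsmul,
    ← monoF_append, runFunctional_monoF]
  by_cases hlen : a.length + N + b.length = w.length
  swap
  · refine Finset.sum_eq_zero fun σ _ => ?_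
    rw [if_neg, smul_zero]
    intro h
    apply hlen
    simpa [add_assoc] using h.1.length_eq
  obtain ⟨i, hi, hle⟩ := hw.exists_le (k := a.length) (by omega)
  set τ : Equiv.Perm (Fin N) := Equiv.swap ⟨i, Nat.lt_of_succ_lt hi⟩ ⟨i + 1, hi⟩ with hτ
  have hτne : (⟨i, by omega⟩ : Fin N) ≠ ⟨i + 1, hi⟩ := by simp [Fin.ext_iff]
  have step : ∀ σ : Equiv.Perm (Fin N),
      RunRearrangement w (a ++ (List.ofFn fun j => g (σ j)) ++ b) →
      RunRearrangement w (a ++ (List.ofFn fun j => g ((σ * τ) j)) ++ b) := by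
    intro σ h
    have e := ofFn_comp_swap (fun j => g (σ j)) hi
    simp only [Equiv.Perm.mul_apply, hτ]
    rw [e]
    rw [ofFn_eq_append_cons_cons (fun j => g (σ j)) hi] at h
    have hc : (a ++ (List.ofFn fun j => g (σ j)).take i).length = a.length + i := by
      simp; omega
    simp only [← List.append_assoc, List.append_assoc _ (_ :: _) b, List.cons_append] at h ⊢
    exact h.swap (by omega) (by simpa only [hc] using hle)
  refine Finset.sum_involution (fun σ _ => σ * τ) (fun σ _ => ?_) (fun σ _ _ => ?_)
    (fun _ _ => Finset.mem_univ _) (fun σ _ => by simp [hτ, mul_assoc])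
  · have hiff : RunRearrangement w (a ++ (List.ofFn fun j => g ((σ * τ) j)) ++ b) ↔
        RunRearrangement w (a ++ (List.ofFn fun j => g (σ j)) ++ b) :=
      ⟨fun h => by simpa [hτ, mul_assoc] using step _ h, step σ⟩
    rw [if_congr hiff rfl rfl, Equiv.Perm.sign_mul, hτ, Equiv.Perm.sign_swap hτne]
    split_ifs <;> simp
  · rw [Ne, mul_eq_left, hτ, Equiv.swap_eq_one_iff]
    exact hτne

lemma runFunctional_eq_zero {w : List (Fin n)} (hw : Admissible n N w)
    {x : FreeAlgebra ℂ (Fin n)} (hx : x ∈ relIdeal n N) : runFunctional w x = 0 := by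
  suffices h : relIdeal n N ≤ LinearMap.ker (runFunctional w) from h hx
  refine Submodule.span_le.2 ?_
  rintro _ ⟨u, r, v, ⟨g, -, rfl⟩, rfl⟩
  rw [SetLike.mem_coe, LinearMap.mem_ker]
  have hu : u ∈ Submodule.span ℂ (Set.range (monoF n)) := span_range_monoF ▸ Submodule.mem_top
  have hv : v ∈ Submodule.span ℂ (Set.range (monoF n)) := span_range_monoF ▸ Submodule.mem_top
  induction hu using Submodule.span_induction with
  | zero => simp
  | add x y _ _ hx hy => rw [add_mul, add_mul, map_add, hx, hy, add_zero]
  | smul c x _ hx => rw [smul_mul_assoc, smul_mul_assoc, map_smul, hx, smul_zero]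
  | mem x hx =>
    obtain ⟨a, rfl⟩ := hx
    induction hv using Submodule.span_induction with
    | zero => simp
    | add x y _ _ hx hy => rw [mul_add, map_add, hx, hy, add_zero]
    | smul c x _ hx => rw [mul_smul_comm, map_smul, hx, smul_zero]
    | mem x hx =>
      obtain ⟨b, rfl⟩ := hx
      exact runFunctional_monomial_mul_relation hw g a b

/-- A word containing an `N`-descent is congruent to a combination of lexicographically smaller
words of the same length. -/
lemma mkQ_monoF_mem_of_not_admissible {S : Submodule ℂ (FreeAlgebra ℂ (Fin n) ⧸ relIdeal n N)}
    {l : List (Fin n)} (hl : ¬ Admissible n N l)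
    (hS : ∀ l' : List (Fin n), l'.length = l.length → l' < l →
      (relIdeal n N).mkQ (monoF n l') ∈ S) :
    (relIdeal n N).mkQ (monoF n l) ∈ S := by
  classical
  obtain ⟨d, rfl, hd, a, b, rfl⟩ := not_not.1 hl
  have hd : d.Pairwise (· > ·) := List.isChain_iff_pairwise.1 hd
  set g : Fin d.length → Fin n := fun i => d.get i.rev with hg
  have hmono : StrictMono g := fun i j hij =>
    List.pairwise_iff_get.1 hd _ _ (Fin.rev_lt_rev.2 hij)
  have hrev : (List.ofFn fun j => g (Fin.revPerm j)) = d := by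
    simp only [hg, Fin.revPerm_apply, Fin.rev_rev, List.ofFn_get]
  have hrel : (relIdeal n d.length).mkQ (monoF n a * (∑ σ : Equiv.Perm (Fin d.length),
      (Equiv.Perm.sign σ : ℤ) • monoF n (List.ofFn fun j => g (σ j))) * monoF n b) = 0 := by
    rw [Submodule.mkQ_apply, Submodule.Quotient.mk_eq_zero]
    exact Submodule.subset_span ⟨_, _, _, ⟨g, hmono, rfl⟩, rfl⟩
  simp only [Finset.mul_sum, Finset.sum_mul, map_sum, mul_smul_comm, smul_mul_assoc, map_zsmul,
    ← monoF_append] at hrel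
  rw [← Finset.add_sum_erase _ _ (Finset.mem_univ Fin.revPerm), hrev] at hrel
  have hmem := S.neg_mem (S.sum_mem (t := Finset.univ.erase Fin.revPerm)
    (f := fun σ : Equiv.Perm (Fin d.length) => (Equiv.Perm.sign σ : ℤ) •
      (relIdeal n d.length).mkQ (monoF n (a ++ (List.ofFn fun j => g (σ j)) ++ b)))
    fun σ hσ => by
      refine zsmul_mem (hS _ (by simp) ?_) _
      rw [List.append_assoc, List.append_assoc]
      refine append_lt_append_left a (append_lt_append_of_perm hd ?_ ?_ b)
      · conv_rhs => rw [← hrev]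
        have := Equiv.Perm.ofFn_comp_perm (Fin.revPerm⁻¹ * σ) fun j => g (Fin.revPerm j)
        simpa [Function.comp_def] using this
      · intro e
        refine Finset.ne_of_mem_erase hσ (Equiv.ext fun j => hmono.injective ?_)
        exact congr_fun (List.ofFn_injective (e.trans hrev.symm)) j)
  rw [← eq_neg_of_add_eq_zero_left hrel] at hmem
  obtain h | h := Int.units_eq_one_or (Equiv.Perm.sign (Fin.revPerm (n := d.length)))
  · simpa [h] using hmem
  · simpa [h] using hmem

lemma mkQ_monoF_mem_span (l : List (Fin n)) :
    (relIdeal n N).mkQ (monoF n l) ∈ Submodule.span ℂ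
      (Set.range (fun l : {l : List (Fin n) // Admissible n N l} =>
        (relIdeal n N).mkQ (monoF n l.1))) := by
  have hwf : {u : List (Fin n) | u.length = l.length}.WellFoundedOn (· < ·) :=
    (List.finite_length_eq (Fin n) l.length).wellFoundedOn
  refine hwf.induction (P := fun u => (relIdeal n N).mkQ (monoF n u) ∈ Submodule.span ℂ
      (Set.range (fun l : {l : List (Fin n) // Admissible n N l} =>
        (relIdeal n N).mkQ (monoF n l.1)))) (x := l) rfl fun u hu ih => ?_
  by_cases hadm : Admissible n N u
  · exact Submodule.subset_span ⟨⟨u, hadm⟩, rfl⟩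
  · exact mkQ_monoF_mem_of_not_admissible hadm fun v hv hlt => ih v (hv.trans hu) hlt

end FreeAlgebra

/-- **The admissible monomials form a linear basis of the `N`-antisymmetrizer algebra**
`A = ℂ⟨x_1,…,x_n⟩ / (∑_σ sgn(σ) x_{i_{σ(1)}}⋯x_{i_{σ(N)}} ; i₁ < ⋯ < i_N)`:
the images of the admissible monomials are linearly independent and span `A`. -/
theorem antisymmetrizer_admissible_basis (n N : ℕ) (h2 : 2 ≤ N) (hn : N ≤ n) :
    LinearIndependent ℂ
      (fun l : {l : List (Fin n) // Admissible n N l} =>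
        (relIdeal n N).mkQ (monoF n l.1)) ∧
    Submodule.span ℂ
      (Set.range (fun l : {l : List (Fin n) // Admissible n N l} =>
        (relIdeal n N).mkQ (monoF n l.1))) = ⊤ := by
  constructor
  · rw [linearIndependent_iff']
    intro s c hsum
    by_contra! hne
    obtain ⟨i, hi, hci⟩ := hne
    classical
    obtain ⟨m, hm, hmax⟩ := Finset.exists_max_image (s.filter fun i => c i ≠ 0) (fun i => i.1)
      ⟨i, Finset.mem_filter.2 ⟨hi, hci⟩⟩
    rw [Finset.mem_filter] at hm
    simp only [← map_smul, ← map_sum] at hsum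
    rw [Submodule.mkQ_apply, Submodule.Quotient.mk_eq_zero] at hsum
    have h0 := runFunctional_eq_zero m.2 hsum
    simp only [map_sum, map_smul, runFunctional_monoF] at h0
    rw [Finset.sum_eq_single_of_mem m hm.1, if_pos (RunRearrangement.refl _)] at h0
    · exact hm.2 (by simpa using h0)
    · intro j hj hjm
      by_cases hcj : c j = 0
      · simp [hcj]
      · rw [if_neg, smul_zero]
        intro h
        exact hjm (Subtype.ext (le_antisymm (hmax j (Finset.mem_filter.2 ⟨hj, hcj⟩)) h.le))
  · rw [eq_top_iff, ← Submodule.range_mkQ (relIdeal n N), LinearMap.range_eq_map,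
      ← span_range_monoF, Submodule.map_span_le]
    rintro _ ⟨l, rfl⟩
    exact mkQ_monoF_mem_span l
end

section
/- Let 2 ≤ N ≤ n be integers, V = ℂ^n with standard basis e_1, …, e_n, and let R ⊆ V^{⊗N} be the span of the antisymmetric tensors ∑_{σ ∈ S_N} sgn(σ) e_{i_{σ(1)}} ⊗ ⋯ ⊗ e_{i_{σ(N)}} for 1 ≤ i_1 < ⋯ < i_N ≤ n. Then for every k ≥ 0 the degree-k homogeneous component A_k = V^{⊗k} / ∑_{a+b=k-N, a,b≥0} V^{⊗a} ⊗ R ⊗ V^{⊗b} of the N-antisymmetrizer algebra has dimension dim_ℂ(A_k) = L(n,N,k). -/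
open Equiv Equiv.Perm

/-- The Young subgroup of permutations preserving the fibres of `c`. -/
def blockPerms {k : ℕ} (c : Fin k → ℕ) : Finset (Perm (Fin k)) :=
  Finset.univ.filter fun τ => ∀ x, c (τ x) = c x

/-- The signed sum of the rearrangements of the word `v` inside the fibres of `c`. -/
noncomputable def blockAlt {n k : ℕ} (c : Fin k → ℕ) (v : Fin k → Fin n) : TP n k :=
  ∑ τ ∈ blockPerms c, (sign τ : ℤ) • (Pi.single (v ∘ τ) 1 : TP n k)

/-- The word `w` is strictly decreasing on every fibre of `c`. -/
def BlockAnti {n k : ℕ} (c : Fin k → ℕ) (w : Fin k → Fin n) : Prop :=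
  ∀ x y, x < y → c x = c y → w y < w x

/-- The tensor `f` is antisymmetric with respect to positions in a common fibre of `c`. -/
def Alternates {n k : ℕ} (c : Fin k → ℕ) (f : TP n k) : Prop :=
  ∀ x y, x ≠ y → c x = c y → ∀ w, f (w ∘ swap x y) = - f w

/-- The partition of the positions having `[a, a + N)` as its only nontrivial block. -/
def window (N a k : ℕ) : Fin k → ℕ := fun x => if a ≤ x ∧ (x : ℕ) < a + N then a else x

section Blocks

variable {n k : ℕ} {c : Fin k → ℕ}

lemma mem_blockPerms {τ : Perm (Fin k)} : τ ∈ blockPerms c ↔ ∀ x, c (τ x) = c x := by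
  simp [blockPerms]

lemma one_mem_blockPerms : (1 : Perm (Fin k)) ∈ blockPerms c := by simp [mem_blockPerms]

lemma mul_mem_blockPerms {τ ρ : Perm (Fin k)} (hτ : τ ∈ blockPerms c) (hρ : ρ ∈ blockPerms c) :
    τ * ρ ∈ blockPerms c := by
  rw [mem_blockPerms] at *
  intro x
  rw [Perm.mul_apply, hτ, hρ]

lemma inv_mem_blockPerms {τ : Perm (Fin k)} (hτ : τ ∈ blockPerms c) : τ⁻¹ ∈ blockPerms c := by
  rw [mem_blockPerms] at *
  intro x
  simpa using (hτ (τ⁻¹ x)).symm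

lemma swap_mem_blockPerms {x y : Fin k} (h : c x = c y) : swap x y ∈ blockPerms c := by
  rw [mem_blockPerms]
  intro z
  rw [swap_apply_def]
  split_ifs <;> simp_all

lemma blockPerms_mono {c' : Fin k → ℕ} (h : ∀ x y, c' x = c' y → c x = c y) :
    blockPerms c' ⊆ blockPerms c := by
  intro τ hτ
  rw [mem_blockPerms] at *
  exact fun x => h _ _ (hτ x)

lemma sum_blockPerms_mul_left {M : Type*} [AddCommMonoid M] {ρ : Perm (Fin k)}
    (hρ : ρ ∈ blockPerms c) (F : Perm (Fin k) → M) :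
    ∑ τ ∈ blockPerms c, F (ρ * τ) = ∑ τ ∈ blockPerms c, F τ := by
  refine Finset.sum_equiv (Equiv.mulLeft ρ)
    (fun τ => ⟨fun h => mul_mem_blockPerms hρ h, fun h => ?_⟩)
    (fun τ _ => rfl)
  simpa using mul_mem_blockPerms (inv_mem_blockPerms hρ) h

lemma sum_blockPerms_mul_right {M : Type*} [AddCommMonoid M] {ρ : Perm (Fin k)}
    (hρ : ρ ∈ blockPerms c) (F : Perm (Fin k) → M) :
    ∑ τ ∈ blockPerms c, F (τ * ρ) = ∑ τ ∈ blockPerms c, F τ := by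
  refine Finset.sum_equiv (Equiv.mulRight ρ)
    (fun τ => ⟨fun h => mul_mem_blockPerms h hρ, fun h => ?_⟩)
    (fun τ _ => rfl)
  simpa using mul_mem_blockPerms h (inv_mem_blockPerms hρ)

lemma sign_mul_self_int {α : Type*} [Fintype α] [DecidableEq α] (τ : Perm α) :
    (sign τ : ℤ) * (sign τ : ℤ) = 1 := by
  rw [← Units.val_mul, Int.units_mul_self, Units.val_one]

lemma blockAlt_comp {ρ : Perm (Fin k)} (hρ : ρ ∈ blockPerms c) (v : Fin k → Fin n) :
    blockAlt c (v ∘ ρ) = (sign ρ : ℤ) • blockAlt c v := by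
  unfold blockAlt
  conv_rhs => rw [← sum_blockPerms_mul_left hρ]
  rw [Finset.smul_sum]
  refine Finset.sum_congr rfl fun τ _ => ?_
  rw [smul_smul, Perm.sign_mul, Units.val_mul, ← mul_assoc, sign_mul_self_int, one_mul]
  rfl

lemma blockAlt_eq_zero {v : Fin k → Fin n} {x y : Fin k} (hxy : x ≠ y) (hc : c x = c y)
    (hv : v x = v y) : blockAlt c v = 0 := by
  have h := blockAlt_comp (swap_mem_blockPerms hc) v
  have hs : v ∘ swap x y = v := by
    funext z
    simp only [Function.comp, swap_apply_def]
    split_ifs <;> simp_all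
  rw [hs, sign_swap hxy] at h
  have h2 : blockAlt c v = - blockAlt c v := by simpa using h
  exact self_eq_neg.mp h2

lemma exists_sort {v : Fin k → Fin n} (hv : ∀ x y, c x = c y → v x = v y → x = y) :
    ∃ ρ ∈ blockPerms c, BlockAnti c (v ∘ ρ) := by
  obtain ⟨ρ, hρ, hmax⟩ := Finset.exists_max_image (blockPerms c) (fun ρ => toLex (v ∘ ρ))
    ⟨1, one_mem_blockPerms⟩
  refine ⟨ρ, hρ, fun x y hxy hc => ?_⟩
  by_contra hlt
  have hne : v (ρ x) ≠ v (ρ y) := fun h => hxy.ne (ρ.injective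
    (hv _ _ (by rw [mem_blockPerms.mp hρ, mem_blockPerms.mp hρ, hc]) h))
  have hlt' : v (ρ x) < v (ρ y) := lt_of_le_of_ne (not_lt.mp hlt) hne
  refine absurd (hmax _ (mul_mem_blockPerms hρ (swap_mem_blockPerms hc))) (not_le.mpr ?_)
  refine ⟨x, fun z hz => ?_, ?_⟩
  · simp [swap_apply_of_ne_of_ne hz.ne (hz.trans hxy).ne]
  · simpa using hlt'

lemma BlockAnti.injOn {w : Fin k → Fin n} (hw : BlockAnti c w) {x y : Fin k} (hc : c x = c y)
    (h : w x = w y) : x = y := by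
  rcases lt_trichotomy x y with hlt | heq | hlt
  · exact absurd h (hw _ _ hlt hc).ne'
  · exact heq
  · exact absurd h (hw _ _ hlt hc.symm).ne

lemma BlockAnti.comp_lt {w : Fin k → Fin n} (hw : BlockAnti c w) {τ : Perm (Fin k)}
    (hτ : τ ∈ blockPerms c) (h1 : τ ≠ 1) : toLex (w ∘ τ) < toLex w := by
  have hne : (Finset.univ.filter fun x => τ x ≠ x).Nonempty := by
    by_contra h
    rw [Finset.not_nonempty_iff_eq_empty, Finset.filter_eq_empty_iff] at h
    exact h1 (Equiv.ext fun x => by simpa using h (Finset.mem_univ x))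
  obtain ⟨x, hx, hmin⟩ := Finset.exists_min_image _ id hne
  have hfix : ∀ z < x, τ z = z := by
    intro z hz
    by_contra h
    exact absurd (hmin z (by simpa using h)) (not_le.mpr hz)
  have hx' : τ x ≠ x := by simpa using hx
  refine ⟨x, fun z hz => by simp [hfix z hz], ?_⟩
  have hlt : x < τ x := by
    refine lt_of_le_of_ne (not_lt.mp fun h => ?_) hx'.symm
    exact hx' (τ.injective (hfix _ h))
  exact hw _ _ hlt (mem_blockPerms.mp hτ x).symm

lemma BlockAnti.comp_le {w : Fin k → Fin n} (hw : BlockAnti c w) {τ : Perm (Fin k)}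
    (hτ : τ ∈ blockPerms c) : toLex (w ∘ τ) ≤ toLex w := by
  by_cases h : τ = 1
  · subst h; exact le_rfl
  · exact (hw.comp_lt hτ h).le

lemma blockAlt_apply (v w : Fin k → Fin n) : blockAlt c v w =
    ∑ τ ∈ blockPerms c, if w = v ∘ τ then ((sign τ : ℤ) : ℂ) else 0 := by
  simp [blockAlt, Finset.sum_apply, Pi.single_apply]

lemma BlockAnti.blockAlt_self {w : Fin k → Fin n} (hw : BlockAnti c w) : blockAlt c w w = 1 := by
  rw [blockAlt_apply, Finset.sum_eq_single 1]
  · simp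
  · intro τ hτ h1
    rw [if_neg]
    intro h
    have := hw.comp_lt hτ h1
    rw [← h] at this
    exact lt_irrefl _ this
  · intro h
    exact absurd one_mem_blockPerms h

lemma BlockAnti.le_of_blockAlt_ne_zero {w v : Fin k → Fin n} (hw : BlockAnti c w)
    (h : blockAlt c w v ≠ 0) : toLex v ≤ toLex w := by
  rw [blockAlt_apply] at h
  obtain ⟨τ, hτ, h⟩ := Finset.exists_ne_zero_of_sum_ne_zero h
  have : v = w ∘ τ := by
    by_contra h'
    exact h (if_neg h')
  rw [this]
  exact hw.comp_le hτ

lemma Alternates.comp {f : TP n k} (hf : Alternates c f) {τ : Perm (Fin k)}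
    (hτ : τ ∈ blockPerms c) (w : Fin k → Fin n) : f (w ∘ τ) = (sign τ : ℤ) * f w := by
  induction hs : τ.support.card using Nat.strong_induction_on generalizing τ w with
  | _ m ih =>
    by_cases h1 : τ = 1
    · subst h1; simp
    · obtain ⟨x, hx⟩ : ∃ x, τ x ≠ x := by
        by_contra! h
        exact h1 (Equiv.ext h)
      have hcx : c x = c (τ x) := (mem_blockPerms.mp hτ x).symm
      have hmem := mul_mem_blockPerms (swap_mem_blockPerms hcx) hτ
      have hτ' : τ = swap x (τ x) * (swap x (τ x) * τ) := by
        rw [← mul_assoc, swap_mul_self, one_mul]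
      have key := ih _ (hs ▸ card_support_swap_mul hx) hmem (w ∘ swap x (τ x)) rfl
      have e : (w ∘ swap x (τ x)) ∘ (swap x (τ x) * τ : Perm (Fin k)) = w ∘ τ := by
        conv_rhs => rw [hτ']
        rfl
      rw [e, hf _ _ hx.symm hcx, Perm.sign_mul, sign_swap hx.symm] at key
      rw [key]
      push_cast
      ring

lemma blockAlt_alternates (v : Fin k → Fin n) : Alternates c (blockAlt c v) := by
  intro x y hxy hc w
  rw [blockAlt_apply, blockAlt_apply, ← sum_blockPerms_mul_right (swap_mem_blockPerms hc),
    ← Finset.sum_neg_distrib]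
  refine Finset.sum_congr rfl fun τ _ => ?_
  have : w ∘ swap x y = v ∘ (τ * swap x y : Perm (Fin k)) ↔ w = v ∘ τ :=
    ((swap x y).surjective.injective_comp_right (γ := Fin n)).eq_iff (a := w) (b := v ∘ τ)
  simp only [this, Perm.sign_mul, sign_swap hxy]
  split_ifs <;> simp

lemma blockPerms_card_ne_zero : ((blockPerms c).card : ℂ) ≠ 0 := by
  exact_mod_cast (Finset.card_pos.mpr ⟨1, one_mem_blockPerms⟩).ne'

/-- The span of all `blockAlt c v` is the space of `c`-alternating tensors. -/
lemma mem_span_blockAlt {f : TP n k} :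
    f ∈ Submodule.span ℂ (Set.range (blockAlt c : (Fin k → Fin n) → TP n k)) ↔
      Alternates c f := by
  constructor
  · intro hf
    induction hf using Submodule.span_induction with
    | mem f hf => obtain ⟨v, rfl⟩ := hf; exact blockAlt_alternates v
    | zero => intro x y _ _ w; simp
    | add f g _ _ hf hg =>
      intro x y hxy hc w
      simp only [Pi.add_apply, hf x y hxy hc w, hg x y hxy hc w]
      ring
    | smul r f _ hf =>
      intro x y hxy hc w
      simp only [Pi.smul_apply, hf x y hxy hc w, smul_neg]
  · intro hf
    have key : ((blockPerms c).card : ℂ) • f = ∑ v, f v • blockAlt c v := by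
      funext w
      simp only [Finset.sum_apply, Pi.smul_apply, blockAlt_apply, smul_eq_mul, Finset.mul_sum]
      rw [Finset.sum_comm, Finset.card_eq_sum_ones, Nat.cast_sum, Finset.sum_mul]
      refine Finset.sum_congr rfl fun τ hτ => ?_
      rw [Finset.sum_eq_single (w ∘ (τ⁻¹ : Perm (Fin k)))]
      · have e : w = (w ∘ (τ⁻¹ : Perm (Fin k))) ∘ τ := by funext z; simp
        rw [if_pos e]
        nth_rewrite 1 [e]
        rw [hf.comp hτ]
        push_cast
        ring
      · intro v _ hv
        rw [if_neg, mul_zero]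
        rintro rfl
        exact hv (by funext z; simp)
      · simp
    have e : f = ((blockPerms c).card : ℂ)⁻¹ • ∑ v, f v • blockAlt c v := by
      rw [← key, smul_smul, inv_mul_cancel₀ blockPerms_card_ne_zero, one_smul]
    rw [e]
    exact Submodule.smul_mem _ _ (Submodule.sum_mem _ fun v _ =>
      Submodule.smul_mem _ _ (Submodule.subset_span ⟨v, rfl⟩))

lemma blockAlt_mem_of_sorted {S : Submodule ℂ (TP n k)} {v : Fin k → Fin n}
    (h : ∀ ρ ∈ blockPerms c, BlockAnti c (v ∘ ρ) → blockAlt c (v ∘ ρ) ∈ S) :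
    blockAlt c v ∈ S := by
  by_cases hv : ∀ x y, c x = c y → v x = v y → x = y
  · obtain ⟨ρ, hρ, hs⟩ := exists_sort hv
    have h1 := h ρ hρ hs
    rw [blockAlt_comp hρ] at h1
    have h2 := S.smul_of_tower_mem (sign ρ : ℤ) h1
    rwa [smul_smul, sign_mul_self_int, one_smul] at h2
  · push Not at hv
    obtain ⟨x, y, hc, hxy, hne⟩ := hv
    rw [blockAlt_eq_zero hne hc hxy]
    exact S.zero_mem

/-- Refining the partition changes `blockAlt c w` only by lower terms. -/
lemma BlockAnti.blockAlt_sub_mem {c' : Fin k → ℕ} (hcc : ∀ x y, c' x = c' y → c x = c y)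
    {w : Fin k → Fin n} (hw : BlockAnti c w) {S : Submodule ℂ (TP n k)}
    (hS : ∀ v, BlockAnti c' v → toLex v < toLex w → blockAlt c' v ∈ S) :
    blockAlt c' w - blockAlt c w ∈ S := by
  have h1 : ∑ τ ∈ blockPerms c, (sign τ : ℤ) • blockAlt c' (w ∘ τ) =
      ((blockPerms c').card : ℂ) • blockAlt c w := by
    have : ∀ τ : Perm (Fin k), (sign τ : ℤ) • blockAlt c' (w ∘ τ) = ∑ ρ ∈ blockPerms c',
        (sign (τ * ρ) : ℤ) • (Pi.single (w ∘ (τ * ρ : Perm (Fin k))) 1 : TP n k) := by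
      intro τ
      rw [blockAlt, Finset.smul_sum]
      refine Finset.sum_congr rfl fun ρ _ => ?_
      rw [smul_smul, Perm.sign_mul, Units.val_mul]
      rfl
    simp only [this]
    rw [Finset.sum_comm, Nat.cast_smul_eq_nsmul, ← Finset.sum_const]
    refine Finset.sum_congr rfl fun ρ hρ => ?_
    exact sum_blockPerms_mul_right (blockPerms_mono hcc hρ)
      fun τ => (sign τ : ℤ) • (Pi.single (w ∘ τ) 1 : TP n k)
  have h2 : ∑ τ ∈ blockPerms c', (sign τ : ℤ) • blockAlt c' (w ∘ τ) =
      ((blockPerms c').card : ℂ) • blockAlt c' w := by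
    rw [Nat.cast_smul_eq_nsmul, ← Finset.sum_const]
    refine Finset.sum_congr rfl fun τ hτ => ?_
    rw [blockAlt_comp hτ, smul_smul, sign_mul_self_int, one_smul]
  have h3 : ∑ τ ∈ blockPerms c \ blockPerms c', (sign τ : ℤ) • blockAlt c' (w ∘ τ) ∈ S := by
    refine Submodule.sum_mem _ fun τ hτ => S.smul_of_tower_mem _ ?_
    rw [Finset.mem_sdiff] at hτ
    refine blockAlt_mem_of_sorted fun ρ hρ hs => hS _ hs ?_
    refine hw.comp_lt (τ := τ * ρ) (mul_mem_blockPerms hτ.1 (blockPerms_mono hcc hρ)) fun h => ?_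
    rw [mul_eq_one_iff_eq_inv] at h
    exact hτ.2 (h ▸ inv_mem_blockPerms hρ)
  rw [← Finset.sum_sdiff (blockPerms_mono hcc), h2] at h1
  have h4 : blockAlt c' w - blockAlt c w = -(((blockPerms c').card : ℂ)⁻¹ •
      ∑ τ ∈ blockPerms c \ blockPerms c', (sign τ : ℤ) • blockAlt c' (w ∘ τ)) := by
    rw [eq_sub_of_add_eq h1, smul_sub, smul_smul, smul_smul,
      inv_mul_cancel₀ blockPerms_card_ne_zero, one_smul, one_smul, neg_sub]
  rw [h4]
  exact S.neg_mem (S.smul_mem _ h3)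

end Blocks

section Ideal

variable {n N : ℕ}

lemma antisymmetrizer_eq_blockAlt (g : Fin N → Fin n) :
    (∑ σ : Perm (Fin N), (sign σ : ℤ) •
      fun u : Fin N → Fin n => if u = g ∘ σ then (1 : ℂ) else 0) =
      blockAlt (fun _ => 0) g := by
  funext u
  rw [blockAlt_apply]
  simp [Finset.sum_apply, blockPerms]

lemma mem_antisymR {f : TP n N} : f ∈ antisymR n N ↔ Alternates (fun _ => 0) f := by
  rw [← mem_span_blockAlt]
  suffices h : antisymR n N = Submodule.span ℂ
      (Set.range (blockAlt (fun _ => 0) : (Fin N → Fin n) → TP n N)) by rw [h]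
  apply le_antisymm
  · refine Submodule.span_mono ?_
    rintro f ⟨g, -, rfl⟩
    exact ⟨g, (antisymmetrizer_eq_blockAlt g).symm⟩
  · rw [Submodule.span_le]
    rintro _ ⟨v, rfl⟩
    refine blockAlt_mem_of_sorted fun ρ _ hs => ?_
    have hr : (Fin.revPerm : Perm (Fin N)) ∈ blockPerms (fun _ : Fin N => 0) := by
      simp [mem_blockPerms]
    have h1 : blockAlt (fun _ => 0) ((v ∘ ρ) ∘ Fin.revPerm) ∈ antisymR n N := by
      refine Submodule.subset_span ⟨_, fun x y hxy => ?_, (antisymmetrizer_eq_blockAlt _).symm⟩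
      exact hs _ _ (by simpa using hxy) rfl
    rw [blockAlt_comp hr] at h1
    have h2 := (antisymR n N).smul_of_tower_mem (sign (Fin.revPerm : Perm (Fin N)) : ℤ) h1
    rwa [smul_smul, sign_mul_self_int, one_smul] at h2

lemma append_comp_swap {a b : ℕ} (p : Fin a → Fin n) (u : Fin N → Fin n) (s : Fin b → Fin n)
    (x y : Fin N) :
    Fin.append (Fin.append p u) s ∘
        swap (Fin.castAdd b (Fin.natAdd a x)) (Fin.castAdd b (Fin.natAdd a y)) =
      Fin.append (Fin.append p (u ∘ swap x y)) s := by
  funext i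
  simp only [Function.comp]
  refine Fin.addCases (fun j => ?_) (fun j => ?_) i
  · refine Fin.addCases (fun l => ?_) (fun l => ?_) j
    · rw [swap_apply_of_ne_of_ne] <;> (simp [Fin.ext_iff]; try omega)
    · have hinj : Function.Injective fun z : Fin N => Fin.castAdd b (Fin.natAdd a z) := by
        intro z z' h
        simpa [Fin.ext_iff] using h
      have := hinj.swap_apply x y l
      rw [this]
      simp
  · rw [swap_apply_of_ne_of_ne] <;> (simp [Fin.ext_iff]; try omega)

lemma mem_midSub {a b m : ℕ} (h : a + N + b = m) {f : TP n m} :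
    f ∈ midSub n N (antisymR n N) h ↔ Alternates (window N a m) f := by
  subst h
  simp only [midSub, Submodule.mem_iInf, Submodule.mem_comap, mem_antisymR]
  have hsl : ∀ (p : Fin a → Fin n) (s : Fin b → Fin n) (u : Fin N → Fin n),
      sliceMap n N rfl p s f u = f (Fin.append (Fin.append p u) s) := fun p s u => rfl
  constructor
  · intro hf x y hxy hc w
    have hw : ∀ x, window N a (a + N + b) x = if a ≤ x ∧ (x : ℕ) < a + N then a else x :=
      fun _ => rfl
    have hx : a ≤ x ∧ (x : ℕ) < a + N := by
      by_contra hx; have := Fin.val_ne_of_ne hxy; simp only [hw] at hc; split_ifs at hc <;> omega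
    have hy : a ≤ y ∧ (y : ℕ) < a + N := by
      by_contra hy; have := Fin.val_ne_of_ne hxy; simp only [hw] at hc; split_ifs at hc <;> omega
    obtain ⟨x', rfl⟩ : ∃ x', x = Fin.castAdd b (Fin.natAdd a x') :=
      ⟨⟨x - a, by omega⟩, by ext; simp; omega⟩
    obtain ⟨y', rfl⟩ : ∃ y', y = Fin.castAdd b (Fin.natAdd a y') :=
      ⟨⟨y - a, by omega⟩, by ext; simp; omega⟩
    obtain ⟨p, u, s, rfl⟩ : ∃ p u s, w = Fin.append (Fin.append p u) s :=
      ⟨fun i => w (Fin.castAdd b (Fin.castAdd N i)), fun i => w (Fin.castAdd b (Fin.natAdd a i)),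
        fun i => w (Fin.natAdd (a + N) i), by
          funext i
          refine Fin.addCases (fun j => ?_) (fun j => ?_) i
          · refine Fin.addCases (fun l => ?_) (fun l => ?_) j <;> simp
          · simp⟩
    rw [append_comp_swap, ← hsl, ← hsl]
    exact hf p s x' y' (fun h => hxy (by rw [h])) rfl u
  · intro hf p s x y hxy _ u
    rw [hsl, hsl, ← append_comp_swap]
    refine hf _ _ (fun h => hxy (by simpa [Fin.ext_iff] using h)) ?_ _
    simp [window]

lemma blockAlt_mem_idealSub {k a : ℕ} (ha : a + N ≤ k) (v : Fin k → Fin n) :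
    blockAlt (window N a k) v ∈ idealSub n N (antisymR n N) k := by
  have h : a + N + (k - (a + N)) = k := by omega
  exact Submodule.mem_iSup_of_mem (a, k - (a + N)) (Submodule.mem_iSup_of_mem h
    ((mem_midSub h).mpr (blockAlt_alternates v)))

lemma idealSub_le {k : ℕ} {S : Submodule ℂ (TP n k)}
    (hS : ∀ a, a + N ≤ k → ∀ w, BlockAnti (window N a k) w → blockAlt (window N a k) w ∈ S) :
    idealSub n N (antisymR n N) k ≤ S := by
  refine iSup_le fun ab => iSup_le fun h f hf => ?_
  rw [mem_midSub, ← mem_span_blockAlt] at hf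
  revert f
  change _ ≤ S
  rw [Submodule.span_le]
  rintro _ ⟨v, rfl⟩
  exact blockAlt_mem_of_sorted fun ρ _ hs => hS _ (by omega) _ hs

/-- Two descent windows of a word lie in a common partition on whose blocks the word decreases. -/
lemma exists_common_blocks {k a b : ℕ} (hab : a ≤ b) {w : Fin k → Fin n} (hb : b + N ≤ k)
    (hwa : BlockAnti (window N a k) w) (hwb : BlockAnti (window N b k) w) :
    ∃ c : Fin k → ℕ, BlockAnti c w ∧ (∀ x y, window N a k x = window N a k y → c x = c y) ∧
      ∀ x y, window N b k x = window N b k y → c x = c y := by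
  have hA : ∀ x y : Fin k, x < y → a ≤ x → (y : ℕ) < a + N → w y < w x := fun x y hxy hx hy =>
    hwa x y hxy (by simp only [window]; rw [if_pos (by omega), if_pos (by omega)])
  have hB : ∀ x y : Fin k, x < y → b ≤ x → (y : ℕ) < b + N → w y < w x := fun x y hxy hx hy =>
    hwb x y hxy (by simp only [window]; rw [if_pos (by omega), if_pos (by omega)])
  by_cases hlt : b < a + N
  · refine ⟨fun x => if a ≤ x ∧ (x : ℕ) < b + N then a else x, ?_, ?_, ?_⟩
    · intro x y hxy hc
      have hxy' : (x : ℕ) < y := hxy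
      have hx : a ≤ x ∧ (y : ℕ) < b + N := by
        simp only at hc; split_ifs at hc <;> omega
      by_cases hy : (y : ℕ) < a + N
      · exact hA x y hxy hx.1 hy
      · by_cases hx' : b ≤ x
        · exact hB x y hxy hx' hx.2
        · have h1 := hA x ⟨b, by omega⟩ (by rw [Fin.lt_def]; simp; omega) hx.1 hlt
          have h2 := hB ⟨b, by omega⟩ y (by rw [Fin.lt_def]; simp; omega) le_rfl hx.2
          exact h2.trans h1
    · intro x y h
      simp only [window] at h ⊢
      split_ifs at h ⊢ <;> omega
    · intro x y h
      simp only [window] at h ⊢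
      split_ifs at h ⊢ <;> omega
  · refine ⟨fun x => if a ≤ x ∧ (x : ℕ) < a + N then a else
      if b ≤ x ∧ (x : ℕ) < b + N then b else x, ?_, ?_, ?_⟩
    · intro x y hxy hc
      have hxy' : (x : ℕ) < y := hxy
      have : (a ≤ x ∧ (y : ℕ) < a + N) ∨ (b ≤ x ∧ (y : ℕ) < b + N) := by
        simp only at hc; split_ifs at hc <;> omega
      rcases this with h | h
      · exact hA x y hxy h.1 h.2
      · exact hB x y hxy h.1 h.2
    · intro x y h
      simp only [window] at h ⊢
      split_ifs at h ⊢ <;> omega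
    · intro x y h
      simp only [window] at h ⊢
      split_ifs at h ⊢ <;> omega

lemma blockAlt_sub_blockAlt_mem {k a b : ℕ} (ha : a + N ≤ k) (hb : b + N ≤ k)
    {w : Fin k → Fin n} (hwa : BlockAnti (window N a k) w) (hwb : BlockAnti (window N b k) w)
    {S : Submodule ℂ (TP n k)}
    (hS : ∀ v, toLex v < toLex w → ∀ a, a + N ≤ k → BlockAnti (window N a k) v →
      blockAlt (window N a k) v ∈ S) :
    blockAlt (window N a k) w - blockAlt (window N b k) w ∈ S := by
  wlog hab : a ≤ b generalizing a b
  · rw [← neg_sub]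
    exact S.neg_mem (this hb ha hwb hwa (by omega))
  obtain ⟨c, hc, h1, h2⟩ := exists_common_blocks hab hb hwa hwb
  have := S.sub_mem (hc.blockAlt_sub_mem h1 fun v hv hlt => hS v hlt a ha hv)
    (hc.blockAlt_sub_mem h2 fun v hv hlt => hS v hlt b hb hv)
  simpa using this

/-- The word `w` has an `N`-descent. -/
def HasDescent (N : ℕ) {k : ℕ} (w : Fin k → Fin n) : Prop :=
  ∃ a, a + N ≤ k ∧ BlockAnti (window N a k) w

lemma finrank_idealSub (k : ℕ) : Module.finrank ℂ (idealSub n N (antisymR n N) k) =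
    Nat.card {w : Fin k → Fin n // HasDescent N w} := by
  classical
  choose a ha haw using fun w : {w : Fin k → Fin n // HasDescent N w} => w.2
  let e : {w : Fin k → Fin n // HasDescent N w} → TP n k :=
    fun w => blockAlt (window N (a w) k) w.1
  have hspan : Submodule.span ℂ (Set.range e) = idealSub n N (antisymR n N) k := by
    apply le_antisymm
    · rw [Submodule.span_le]
      rintro _ ⟨w, rfl⟩
      exact blockAlt_mem_idealSub (ha w) _
    · suffices h : ∀ w : Lex (Fin k → Fin n), ∀ b, b + N ≤ k →
          BlockAnti (window N b k) (ofLex w) →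
          blockAlt (window N b k) (ofLex w) ∈ Submodule.span ℂ (Set.range e) from
        idealSub_le fun b hb w hw => h (toLex w) b hb hw
      intro w
      induction w using WellFoundedLT.induction with
      | ind w ih =>
        intro b hb hw
        have h1 := blockAlt_sub_blockAlt_mem hb (ha ⟨ofLex w, b, hb, hw⟩) hw (haw _)
          (S := Submodule.span ℂ (Set.range e)) fun v hv => ih (toLex v) hv
        have h2 : e ⟨ofLex w, b, hb, hw⟩ ∈ Submodule.span ℂ (Set.range e) :=
          Submodule.subset_span ⟨_, rfl⟩
        simpa [e] using Submodule.add_mem _ h1 h2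
  have hind : LinearIndependent ℂ e := by
    rw [Fintype.linearIndependent_iff]
    intro g hg
    by_contra! hne
    obtain ⟨i, hi⟩ := hne
    obtain ⟨w, hw, hmax⟩ := Finset.exists_max_image (Finset.univ.filter fun w => g w ≠ 0)
      (fun w => toLex w.1) ⟨i, by simpa using hi⟩
    have h := congrFun hg w.1
    rw [Finset.sum_apply, Finset.sum_eq_single w] at h
    · simp only [Pi.smul_apply, e, (haw w).blockAlt_self, Pi.zero_apply, smul_eq_mul,
        mul_one] at h
      exact (Finset.mem_filter.mp hw).2 h
    · intro v _ hv
      by_cases hgv : g v = 0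
      · simp [hgv]
      · by_cases hz : e v w.1 = 0
        · simp [hz]
        · exact absurd (Subtype.ext (toLex.injective
            (le_antisymm (hmax v (by simpa using hgv)) ((haw v).le_of_blockAlt_ne_zero hz)))) hv
    · simp
  rw [← hspan, finrank_span_eq_card hind, Nat.card_eq_fintype_card]

lemma admissible_ofFn {k : ℕ} (w : Fin k → Fin n) :
    Admissible n N (List.ofFn w) ↔ ¬ HasDescent N w := by
  unfold Admissible HasDescent
  refine not_congr ⟨?_, ?_⟩
  · rintro ⟨u, hu, hch, p, s, hps⟩
    have hlen := congrArg List.length hps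
    simp only [List.length_append, List.length_ofFn] at hlen
    refine ⟨p.length, by omega, fun x y hxy hc => ?_⟩
    have hxy' : (x : ℕ) < y := hxy
    have hb : p.length ≤ x ∧ (y : ℕ) < p.length + N := by
      simp only [window] at hc; split_ifs at hc <;> omega
    have hget : ∀ (z : Fin k) (hz : p.length ≤ z) (hz' : (z : ℕ) < p.length + N),
        w z = u[(z : ℕ) - p.length]'(by omega) := by
      intro z hz hz'
      have : (p ++ u ++ s)[(z : ℕ)]? = (List.ofFn w)[(z : ℕ)]? := by rw [hps]
      rw [List.append_assoc, List.getElem?_append_right hz,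
        List.getElem?_append_left (by omega)] at this
      rw [List.getElem?_eq_getElem (by omega), List.getElem?_eq_getElem (by simp)] at this
      simpa using this.symm
    rw [hget x hb.1 (by omega), hget y (by omega) hb.2]
    have hpw := List.isChain_iff_pairwise.mp hch
    exact List.pairwise_iff_getElem.mp hpw _ _ _ _ (by omega)
  · rintro ⟨a, ha, hw⟩
    refine ⟨((List.ofFn w).drop a).take N, by simp; omega, ?_,
      ((List.take_prefix _ _).isInfix).trans (List.drop_suffix _ _).isInfix⟩
    refine List.isChain_iff_pairwise.mpr (List.pairwise_iff_getElem.mpr fun i j hi hj hij => ?_)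
    simp only [List.length_take, List.length_drop, List.length_ofFn] at hi hj
    simp only [List.getElem_take, List.getElem_drop, List.getElem_ofFn]
    refine hw _ _ (by rw [Fin.lt_def]; simp; omega) ?_
    simp only [window]
    rw [if_pos (by omega), if_pos (by omega)]

lemma card_admissible (k : ℕ) :
    Nat.card {l : List (Fin n) // l.length = k ∧ Admissible n N l} =
      Nat.card {w : Fin k → Fin n // ¬ HasDescent N w} := by
  refine (Nat.card_eq_of_bijective (fun w => ⟨List.ofFn w.1, by simp,
    (admissible_ofFn w.1).mpr w.2⟩) ⟨?_, ?_⟩).symm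
  · intro w w' h
    exact Subtype.ext (List.ofFn_injective (congrArg Subtype.val h))
  · rintro ⟨l, rfl, hl⟩
    have h : List.ofFn l.get = l := List.ofFn_get l
    exact ⟨⟨l.get, (admissible_ofFn _).mp (h.symm ▸ hl)⟩, Subtype.ext h⟩

end Ideal

/-- **Dimensions of the homogeneous components of the `N`-antisymmetrizer algebra.**
For `2 ≤ N ≤ n`, `dim_ℂ A_k = L(n,N,k)`, the number of admissible words of length `k`. -/
theorem antisymmetrizer_dim_eq_admissible_count (n N : ℕ) (hN : 2 ≤ N) (hn : N ≤ n)
    (k : ℕ) :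
    Module.finrank ℂ (Acomp n N (antisymR n N) k) =
      Nat.card {l : List (Fin n) // l.length = k ∧ Admissible n N l} := by
  classical
  have h1 := Submodule.finrank_quotient_add_finrank (idealSub n N (antisymR n N) k)
  rw [finrank_idealSub, Module.finrank_fintype_fun_eq_card, Nat.card_eq_fintype_card] at h1
  rw [card_admissible, Nat.card_eq_fintype_card, Fintype.card_subtype_compl]
  exact Nat.eq_sub_of_add_eq h1
end

section
/- Let 2 ≤ N ≤ n be integers, V = ℂ^n, and let K ⊆ V^{⊗N} be the kernel of the antisymmetrization operator a_N : V^{⊗N} → V^{⊗N} defined by a_N(v_1 ⊗ ⋯ ⊗ v_N) = ∑_{σ ∈ S_N} sgn(σ) v_{σ(1)} ⊗ ⋯ ⊗ v_{σ(N)}. For m ≥ 0, let B_m = V^{⊗m} / ∑_{a+b=m-N, a,b≥0} V^{⊗a} ⊗ K ⊗ V^{⊗b} (so B_m = V^{⊗m} for m < N). Then dim_ℂ(B_m) = n^m for 0 ≤ m ≤ N−1, dim_ℂ(B_m) = C(n,m) for N ≤ m ≤ n, and dim_ℂ(B_m) = 0 for m > n, where C(n,m) is the binomial coefficient. -/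
/-- The antisymmetrization operator `a_N : V^{⊗N} → V^{⊗N}`,
`a_N(v₁ ⊗ ⋯ ⊗ v_N) = ∑_{σ ∈ S_N} sgn(σ) v_{σ(1)} ⊗ ⋯ ⊗ v_{σ(N)}`: in the function
model it sends `f` to `w ↦ ∑_σ sgn(σ) f(w ∘ σ)`. -/
noncomputable def antisymmetrizer (n N : ℕ) : TP n N →ₗ[ℂ] TP n N :=
  ∑ σ : Equiv.Perm (Fin N), (Equiv.Perm.sign σ : ℤ) •
    LinearMap.funLeft ℂ ℂ (fun w : Fin N → Fin n => w ∘ σ)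

open Equiv.Perm in
theorem antisymmetrizer_apply {n N : ℕ} (f : TP n N) (w : Fin N → Fin n) :
    antisymmetrizer n N f w = ∑ σ : Equiv.Perm (Fin N), ((sign σ : ℤ) : ℂ) * f (w ∘ σ) := by
  simp [antisymmetrizer, LinearMap.sum_apply, Finset.sum_apply, LinearMap.funLeft_apply]

/-- The action of a permutation of the tensor positions on `V^{⊗m}`. -/
noncomputable def permuteTensor (n : ℕ) {m : ℕ} (σ : Equiv.Perm (Fin m)) :
    TP n m →ₗ[ℂ] TP n m :=
  LinearMap.funLeft ℂ ℂ (fun w => w ∘ σ)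

theorem permuteTensor_apply {n m : ℕ} (σ : Equiv.Perm (Fin m)) (f : TP n m)
    (w : Fin m → Fin n) : permuteTensor n σ f w = f (w ∘ σ) := rfl

theorem sign_mul_self_complex {m : ℕ} (σ : Equiv.Perm (Fin m)) :
    ((Equiv.Perm.sign σ : ℤ) : ℂ) * ((Equiv.Perm.sign σ : ℤ) : ℂ) = 1 := by
  rcases Int.units_eq_one_or (Equiv.Perm.sign σ) with h | h <;> simp [h]

theorem antisymmetrizer_apply_comp {n m : ℕ} (f : TP n m) (w : Fin m → Fin n)
    (τ : Equiv.Perm (Fin m)) :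
    antisymmetrizer n m f (w ∘ τ) =
      ((Equiv.Perm.sign τ : ℤ) : ℂ) * antisymmetrizer n m f w := by
  rw [antisymmetrizer_apply, antisymmetrizer_apply, Finset.mul_sum,
    ← Equiv.sum_comp (Equiv.mulLeft τ)
      (fun σ => ((Equiv.Perm.sign τ : ℤ) : ℂ) * (((Equiv.Perm.sign σ : ℤ) : ℂ) * f (w ∘ σ)))]
  refine Finset.sum_congr rfl fun σ _ => ?_
  simp only [Equiv.coe_mulLeft, Equiv.Perm.sign_mul, Units.val_mul, Int.cast_mul,
    Equiv.Perm.coe_mul, Function.comp_assoc]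
  rw [← mul_assoc, ← mul_assoc, sign_mul_self_complex, one_mul]

theorem antisymmetrizer_permuteTensor {n m : ℕ} (τ : Equiv.Perm (Fin m)) (f : TP n m) :
    antisymmetrizer n m (permuteTensor n τ f) =
      ((Equiv.Perm.sign τ : ℤ) : ℂ) • antisymmetrizer n m f := by
  ext w
  rw [Pi.smul_apply, smul_eq_mul, antisymmetrizer_apply, antisymmetrizer_apply, Finset.mul_sum,
    ← Equiv.sum_comp (Equiv.mulRight τ)
      (fun σ => ((Equiv.Perm.sign τ : ℤ) : ℂ) * (((Equiv.Perm.sign σ : ℤ) : ℂ) * f (w ∘ σ)))]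
  refine Finset.sum_congr rfl fun σ _ => ?_
  simp only [Equiv.coe_mulRight, Equiv.Perm.sign_mul, Units.val_mul, Int.cast_mul,
    Equiv.Perm.coe_mul, permuteTensor_apply, Function.comp_assoc]
  linear_combination (-((Equiv.Perm.sign σ : ℤ) : ℂ) * f (w ∘ σ ∘ τ)) * sign_mul_self_complex τ

/-- The inclusion of the middle block of positions. -/
def midEmb {a N b m : ℕ} (h : a + N + b = m) : Fin N ↪ Fin m where
  toFun j := Fin.cast h (Fin.castAdd b (Fin.natAdd a j))
  inj' i j hij := by simpa [Fin.ext_iff] using hij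

theorem midEmb_apply_val {a N b m : ℕ} (h : a + N + b = m) (j : Fin N) :
    (midEmb h j : ℕ) = a + j := rfl

/-- The action of a permutation of the middle block, extended by the identity. -/
def midPerm {a N b m : ℕ} (h : a + N + b = m) (τ : Equiv.Perm (Fin N)) :
    Equiv.Perm (Fin m) :=
  τ.viaFintypeEmbedding (midEmb h)

theorem sign_midPerm {a N b m : ℕ} (h : a + N + b = m) (τ : Equiv.Perm (Fin N)) :
    Equiv.Perm.sign (midPerm h τ) = Equiv.Perm.sign τ :=
  Equiv.Perm.viaFintypeEmbedding_sign _ _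

theorem midPerm_swap {a N b m : ℕ} (h : a + N + b = m) (i j : Fin N) :
    midPerm h (Equiv.swap i j) = Equiv.swap (midEmb h i) (midEmb h j) := by
  ext x
  congr 1
  by_cases hx : x ∈ Set.range (midEmb h)
  · obtain ⟨y, rfl⟩ := hx
    rw [midPerm, Equiv.Perm.viaFintypeEmbedding_apply_image,
      (midEmb h).injective.map_swap]
  · rw [midPerm, Equiv.Perm.viaFintypeEmbedding_apply_notMem_range _ _ hx,
      Equiv.swap_apply_of_ne_of_ne]
    · rintro rfl; exact hx ⟨i, rfl⟩
    · rintro rfl; exact hx ⟨j, rfl⟩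

theorem append_comp_midPerm {α : Type*} {a N b m : ℕ} (h : a + N + b = m)
    (p : Fin a → α) (s : Fin b → α) (u : Fin N → α) (τ : Equiv.Perm (Fin N)) :
    (Fin.append (Fin.append p u) s ∘ Fin.cast h.symm) ∘ midPerm h τ =
      Fin.append (Fin.append p (u ∘ τ)) s ∘ Fin.cast h.symm := by
  subst h
  ext x
  induction x using Fin.addCases with
  | right x =>
    rw [Function.comp_apply, midPerm, Equiv.Perm.viaFintypeEmbedding_apply_notMem_range]
    · simp
    · rintro ⟨y, hy⟩
      have := congrArg Fin.val hy
      rw [midEmb_apply_val] at this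
      simp at this
      omega
  | left x =>
    induction x using Fin.addCases with
    | left x =>
      rw [Function.comp_apply, midPerm, Equiv.Perm.viaFintypeEmbedding_apply_notMem_range]
      · simp
      · rintro ⟨y, hy⟩
        have := congrArg Fin.val hy
        rw [midEmb_apply_val] at this
        simp at this
        omega
    | right x =>
      have hx : Fin.castAdd b (Fin.natAdd a x) = midEmb rfl x := rfl
      rw [Function.comp_apply, hx, midPerm, Equiv.Perm.viaFintypeEmbedding_apply_image]
      simp [midEmb]

theorem sliceMap_permuteTensor {n a N b m : ℕ} (h : a + N + b = m)
    (p : Fin a → Fin n) (s : Fin b → Fin n) (τ : Equiv.Perm (Fin N)) (f : TP n m) :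
    sliceMap n N h p s (permuteTensor n (midPerm h τ) f) =
      permuteTensor n τ (sliceMap n N h p s f) := by
  ext u
  simp only [sliceMap, LinearMap.funLeft_apply, permuteTensor_apply, append_comp_midPerm]

theorem exists_append_eq {α : Type*} {a N b m : ℕ} (h : a + N + b = m) (v : Fin m → α) :
    ∃ (p : Fin a → α) (u : Fin N → α) (s : Fin b → α),
      v = Fin.append (Fin.append p u) s ∘ Fin.cast h.symm := by
  subst h
  refine ⟨fun i => v (Fin.castAdd b (Fin.castAdd N i)), fun i => v (Fin.castAdd b (Fin.natAdd a i)),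
    fun i => v (Fin.natAdd (a + N) i), ?_⟩
  ext x
  induction x using Fin.addCases with
  | right x => simp
  | left x => induction x using Fin.addCases <;> simp

theorem permuteTensor_sub_mem_midSub {n a N b m : ℕ} (h : a + N + b = m)
    (τ : Equiv.Perm (Fin N)) (f : TP n m) :
    permuteTensor n (midPerm h τ) f - ((Equiv.Perm.sign τ : ℤ) : ℂ) • f ∈
      midSub n N (LinearMap.ker (antisymmetrizer n N)) h := by
  simp only [midSub, Submodule.mem_iInf, Submodule.mem_comap, LinearMap.mem_ker]
  intro p s
  rw [map_sub, map_smul, sliceMap_permuteTensor, map_sub, map_smul,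
    antisymmetrizer_permuteTensor, sub_self]

theorem midSub_ker_antisymmetrizer_le {n a N b m : ℕ} (h : a + N + b = m) :
    midSub n N (LinearMap.ker (antisymmetrizer n N)) h ≤
      LinearMap.ker (antisymmetrizer n m) := by
  intro f hf
  simp only [midSub, Submodule.mem_iInf, Submodule.mem_comap, LinearMap.mem_ker] at hf
  have hblock (v : Fin m → Fin n) :
      ∑ τ : Equiv.Perm (Fin N), ((Equiv.Perm.sign τ : ℤ) : ℂ) * f (v ∘ midPerm h τ) = 0 := by
    obtain ⟨p, u, s, rfl⟩ := exists_append_eq h v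
    have := congrFun (hf p s) u
    rw [antisymmetrizer_apply] at this
    simpa only [append_comp_midPerm, sliceMap, LinearMap.funLeft_apply, Pi.zero_apply] using this
  have hsum : ∑ τ : Equiv.Perm (Fin N), ((Equiv.Perm.sign τ : ℤ) : ℂ) •
      antisymmetrizer n m (permuteTensor n (midPerm h τ) f) = 0 := by
    ext w
    simp only [Finset.sum_apply, Pi.smul_apply, smul_eq_mul, antisymmetrizer_apply,
      permuteTensor_apply, Finset.mul_sum, Pi.zero_apply]
    rw [Finset.sum_comm]
    refine Finset.sum_eq_zero fun σ _ => ?_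
    simp_rw [mul_left_comm _ ((Equiv.Perm.sign σ : ℤ) : ℂ)]
    rw [← Finset.mul_sum, hblock, mul_zero]
  simp only [antisymmetrizer_permuteTensor, sign_midPerm, smul_smul, sign_mul_self_complex,
    one_smul, Finset.sum_const, ← Nat.cast_smul_eq_nsmul ℂ] at hsum
  refine (smul_eq_zero.mp hsum).resolve_left ?_
  simp [Fintype.card_perm, Nat.factorial_ne_zero]

theorem permuteTensor_sub_mem_of_adjacent_swap {n k : ℕ} (J : Submodule ℂ (TP n (k + 1)))
    (hJ : ∀ (i : Fin k) (f : TP n (k + 1)),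
      permuteTensor n (Equiv.swap i.castSucc i.succ) f + f ∈ J)
    (σ : Equiv.Perm (Fin (k + 1))) (f : TP n (k + 1)) :
    permuteTensor n σ f - ((Equiv.Perm.sign σ : ℤ) : ℂ) • f ∈ J := by
  have hσ : σ ∈ Submonoid.closure
      (Set.range fun i : Fin k => Equiv.swap i.castSucc i.succ) := by
    rw [Equiv.Perm.mclosure_swap_castSucc_succ]; trivial
  induction hσ using Submonoid.closure_induction generalizing f with
  | mem x hx =>
    obtain ⟨i, rfl⟩ := hx
    have := hJ i f
    simpa [Equiv.Perm.sign_swap (Fin.castSucc_lt_succ (i := i)).ne] using this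
  | one =>
    have : permuteTensor n (1 : Equiv.Perm (Fin (k + 1))) f = f := rfl
    simp [this]
  | mul x y _ _ hx hy =>
    have hcomp : permuteTensor n (x * y) f = permuteTensor n x (permuteTensor n y f) := rfl
    have := J.add_mem (hx (permuteTensor n y f))
      (J.smul_mem ((Equiv.Perm.sign x : ℤ) : ℂ) (hy f))
    rw [hcomp]
    convert this using 1
    simp only [smul_sub, smul_smul, Equiv.Perm.sign_mul, Units.val_mul, Int.cast_mul]
    abel

theorem midSub_le_idealSub {n a N b m : ℕ} (R : Submodule ℂ (TP n N)) (h : a + N + b = m) :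
    midSub n N R h ≤ idealSub n N R m :=
  le_iSup₂_of_le (f := fun (ab : ℕ × ℕ) (h : ab.1 + N + ab.2 = m) => midSub n N R h)
    (a, b) h le_rfl

theorem permuteTensor_swap_add_mem_idealSub {n N k : ℕ} (hN : 2 ≤ N) (hk : N ≤ k + 1)
    (i : Fin k) (f : TP n (k + 1)) :
    permuteTensor n (Equiv.swap i.castSucc i.succ) f + f ∈
      idealSub n N (LinearMap.ker (antisymmetrizer n N)) (k + 1) := by
  obtain ⟨a, b, h, hai, hia⟩ : ∃ a b : ℕ, a + N + b = k + 1 ∧ a ≤ i ∧ (i : ℕ) + 1 < a + N := by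
    have := i.isLt
    rcases le_total (i : ℕ) (k + 1 - N) with hi | hi
    · exact ⟨i, k + 1 - N - i, by omega, le_rfl, by omega⟩
    · exact ⟨k + 1 - N, 0, by omega, hi, by omega⟩
  let j : Fin N := ⟨i - a, by omega⟩
  let j' : Fin N := ⟨i + 1 - a, by omega⟩
  have hj : midEmb h j = i.castSucc := Fin.ext (by rw [midEmb_apply_val]; simp [j]; omega)
  have hj' : midEmb h j' = i.succ := Fin.ext (by rw [midEmb_apply_val]; simp [j']; omega)
  have hne : j ≠ j' := by simp [j, j', Fin.ext_iff]; omega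
  have := midSub_le_idealSub _ h (permuteTensor_sub_mem_midSub h (Equiv.swap j j') f)
  simpa [midPerm_swap, hj, hj', Equiv.Perm.sign_swap hne] using this

theorem idealSub_ker_antisymmetrizer {n N m : ℕ} (hN : 2 ≤ N) (hm : N ≤ m) :
    idealSub n N (LinearMap.ker (antisymmetrizer n N)) m =
      LinearMap.ker (antisymmetrizer n m) := by
  apply le_antisymm
  · exact iSup₂_le fun ab h => midSub_ker_antisymmetrizer_le h
  · obtain ⟨k, rfl⟩ : ∃ k, m = k + 1 := ⟨m - 1, by omega⟩
    intro f hf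
    set J := idealSub n N (LinearMap.ker (antisymmetrizer n N)) (k + 1)
    have hmem : ∑ σ : Equiv.Perm (Fin (k + 1)), ((Equiv.Perm.sign σ : ℤ) : ℂ) •
        (permuteTensor n σ f - ((Equiv.Perm.sign σ : ℤ) : ℂ) • f) ∈ J :=
      J.sum_mem fun σ _ => J.smul_mem _ (permuteTensor_sub_mem_of_adjacent_swap J
        (permuteTensor_swap_add_mem_idealSub hN hm) σ f)
    have hanti : ∑ σ : Equiv.Perm (Fin (k + 1)), ((Equiv.Perm.sign σ : ℤ) : ℂ) •
        permuteTensor n σ f = 0 := by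
      rw [LinearMap.mem_ker] at hf
      rw [← hf]
      ext w
      simp [antisymmetrizer_apply, permuteTensor_apply]
    simp only [smul_sub, Finset.sum_sub_distrib, hanti, smul_smul, sign_mul_self_complex,
      one_smul, Finset.sum_const, zero_sub, ← Nat.cast_smul_eq_nsmul ℂ] at hmem
    refine (J.smul_mem_iff ?_).mp (neg_mem_iff.mp hmem)
    simp [Fintype.card_perm, Nat.factorial_ne_zero]

/-- Antisymmetrization followed by restriction to the strictly increasing words. -/
noncomputable def increasingCoeff (n m : ℕ) : TP n m →ₗ[ℂ] ((Fin m ↪o Fin n) → ℂ) :=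
  LinearMap.funLeft ℂ ℂ (fun e : Fin m ↪o Fin n => (e : Fin m → Fin n)) ∘ₗ antisymmetrizer n m

theorem increasingCoeff_apply {n m : ℕ} (f : TP n m) (e : Fin m ↪o Fin n) :
    increasingCoeff n m f e = antisymmetrizer n m f e := rfl

theorem antisymmetrizer_apply_eq_zero_of_not_injective {n m : ℕ} (f : TP n m)
    {w : Fin m → Fin n} (hw : ¬ Function.Injective w) : antisymmetrizer n m f w = 0 := by
  obtain ⟨i, j, hij, hne⟩ := Function.not_injective_iff.mp hw
  have hswap : w ∘ Equiv.swap i j = w := by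
    ext x
    rw [Function.comp_apply]
    rcases eq_or_ne x i with rfl | hi
    · simp [hij]
    rcases eq_or_ne x j with rfl | hj
    · simp [hij]
    · rw [Equiv.swap_apply_of_ne_of_ne hi hj]
  have := antisymmetrizer_apply_comp f w (Equiv.swap i j)
  rw [hswap, Equiv.Perm.sign_swap hne] at this
  simpa [self_eq_neg] using this

theorem ker_increasingCoeff (n m : ℕ) :
    LinearMap.ker (increasingCoeff n m) = LinearMap.ker (antisymmetrizer n m) := by
  refine le_antisymm (fun f hf => ?_) (LinearMap.ker_le_ker_comp _ _)
  rw [LinearMap.mem_ker] at hf ⊢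
  ext w
  by_cases hw : Function.Injective w
  · have hmono : StrictMono (w ∘ Tuple.sort w) :=
      (Tuple.monotone_sort w).strictMono_of_injective (hw.comp (Tuple.sort w).injective)
    have hzero := congrFun hf (OrderEmbedding.ofStrictMono _ hmono)
    rw [increasingCoeff_apply, OrderEmbedding.coe_ofStrictMono,
      antisymmetrizer_apply_comp] at hzero
    refine (mul_eq_zero.mp hzero).resolve_left fun h0 => ?_
    simpa [h0] using sign_mul_self_complex (Tuple.sort w)
  · exact antisymmetrizer_apply_eq_zero_of_not_injective f hw

theorem eq_of_comp_perm_eq {n m : ℕ} {e e' : Fin m ↪o Fin n} {σ : Equiv.Perm (Fin m)}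
    (h : (e : Fin m → Fin n) ∘ σ = e') : e = e' ∧ σ = 1 := by
  have he : e = e' := by
    rw [← OrderEmbedding.range_inj, ← h, EquivLike.range_comp]
  refine ⟨he, Equiv.ext fun x => e.injective ?_⟩
  subst he
  exact congrFun h x

theorem increasingCoeff_single {n m : ℕ} (e' : Fin m ↪o Fin n) :
    increasingCoeff n m (Pi.single (e' : Fin m → Fin n) 1) = Pi.single e' 1 := by
  ext e
  rw [increasingCoeff_apply, antisymmetrizer_apply]
  rcases eq_or_ne e e' with rfl | hne
  · rw [Finset.sum_eq_single 1]
    · simp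
    · intro σ _ hσ
      rw [Pi.single_eq_of_ne (fun h => hσ (eq_of_comp_perm_eq h).2), mul_zero]
    · simp
  · rw [Pi.single_eq_of_ne hne]
    refine Finset.sum_eq_zero fun σ _ => ?_
    rw [Pi.single_eq_of_ne (fun h => hne (eq_of_comp_perm_eq h).1), mul_zero]

theorem range_increasingCoeff (n m : ℕ) : LinearMap.range (increasingCoeff n m) = ⊤ := by
  rw [eq_top_iff, ← (Pi.basisFun ℂ (Fin m ↪o Fin n)).span_eq, Submodule.span_le]
  rintro _ ⟨e, rfl⟩
  exact ⟨_, (increasingCoeff_single e).trans (Pi.basisFun_apply ℂ _ e).symm⟩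

theorem card_orderEmbedding_fin (n m : ℕ) : Fintype.card (Fin m ↪o Fin n) = n.choose m := by
  rw [← Nat.card_eq_fintype_card, Nat.card_congr Set.powersetCard.ofFinEmbEquiv,
    Set.powersetCard.card, Nat.card_fin]

theorem finrank_quotient_ker_antisymmetrizer (n m : ℕ) :
    Module.finrank ℂ (TP n m ⧸ LinearMap.ker (antisymmetrizer n m)) = n.choose m := by
  rw [← ker_increasingCoeff, (increasingCoeff n m).quotKerEquivRange.finrank_eq,
    range_increasingCoeff, finrank_top, Module.finrank_fintype_fun_eq_card,
    card_orderEmbedding_fin]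

theorem finrank_Acomp_ker_antisymmetrizer {n N m : ℕ} (hN : 2 ≤ N) (hm : N ≤ m) :
    Module.finrank ℂ (Acomp n N (LinearMap.ker (antisymmetrizer n N)) m) = n.choose m := by
  rw [(Submodule.quotEquivOfEq _ _ (idealSub_ker_antisymmetrizer hN hm)).finrank_eq,
    finrank_quotient_ker_antisymmetrizer]

theorem finrank_Acomp_of_lt {n N m : ℕ} (R : Submodule ℂ (TP n N)) (hm : m < N) :
    Module.finrank ℂ (Acomp n N R m) = n ^ m := by
  have hbot : idealSub n N R m = ⊥ :=
    eq_bot_iff.mpr (iSup₂_le fun ab h => absurd h (by omega))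
  rw [(Submodule.quotEquivOfEqBot _ hbot).finrank_eq]
  simp [Module.finrank_fintype_fun_eq_card]

/-- **Dimensions of the homogeneous components of the dual of the `N`-antisymmetrizer
algebra.**  Let `2 ≤ N ≤ n`, `K = ker(a_N) ⊆ V^{⊗N}` the kernel of the antisymmetrization
operator, and `B_m = V^{⊗m} / ∑_{a+N+b=m} V^{⊗a} ⊗ K ⊗ V^{⊗b}`.  Then
`dim B_m = n^m` for `0 ≤ m ≤ N-1`, `dim B_m = C(n,m)` for `N ≤ m ≤ n`, and
`dim B_m = 0` for `m > n`. -/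
theorem dual_antisymmetrizer_dims (n N : ℕ) (hN : 2 ≤ N) (hn : N ≤ n) :
    (∀ m : ℕ, m ≤ N - 1 →
      Module.finrank ℂ (Acomp n N (LinearMap.ker (antisymmetrizer n N)) m) = n ^ m) ∧
    (∀ m : ℕ, N ≤ m → m ≤ n →
      Module.finrank ℂ (Acomp n N (LinearMap.ker (antisymmetrizer n N)) m) =
        Nat.choose n m) ∧
    (∀ m : ℕ, n < m →
      Module.finrank ℂ (Acomp n N (LinearMap.ker (antisymmetrizer n N)) m) = 0) := by
  exact ⟨fun m hm => finrank_Acomp_of_lt _ (by omega),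
    fun m hm _ => finrank_Acomp_ker_antisymmetrizer hN hm,
    fun m hm => by
      rw [finrank_Acomp_ker_antisymmetrizer hN (by omega), Nat.choose_eq_zero_of_lt hm]⟩
end

section
/- (MacMahon Master Theorem) Let n ≥ 1 and let Z = (z_{ij}) be an n × n complex matrix. For m = (m_1, …, m_n) ∈ ℕ^n, let G(m) ∈ ℂ be the coefficient of the monomial x_1^{m_1} ⋯ x_n^{m_n} in the polynomial ∏_{i=1}^n (∑_{j=1}^n z_{ij} x_j)^{m_i} ∈ ℂ[x_1, …, x_n]. Then, in the formal power series ring ℂ[[t_1, …, t_n]], (∑_{m ∈ ℕ^n} G(m) t_1^{m_1} ⋯ t_n^{m_n}) · det(I_n − Z T) = 1, where T = diag(t_1, …, t_n) and det(I_n − Z T) is viewed as a polynomial in t_1, …, t_n (with constant term 1, hence invertible in ℂ[[t_1, …, t_n]]). -/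
open MvPolynomial

/-- `Gcoeff Z m` is the coefficient of the monomial `x₁^{m₁} ⋯ x_n^{m_n}` in
`∏ i, (∑ j, z_{ij} x_j)^{m_i}`. -/
noncomputable def Gcoeff {n : ℕ} (Z : Matrix (Fin n) (Fin n) ℂ) (m : Fin n →₀ ℕ) : ℂ :=
  MvPolynomial.coeff m (∏ i : Fin n, (∑ j : Fin n, C (Z i j) * X j) ^ m i)

/-- The generating series `∑_{m ∈ ℕⁿ} G(m) t₁^{m₁} ⋯ t_n^{m_n} ∈ ℂ[[t₁,…,t_n]]`. -/
noncomputable def bosSeries {n : ℕ} (Z : Matrix (Fin n) (Fin n) ℂ) :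
    MvPowerSeries (Fin n) ℂ :=
  fun m => Gcoeff Z m

open Finset in
/-- Multiplying `bosSeries Z` by a product of affine factors `a i + b i * t i` and taking the
coefficient at `m` amounts to replacing `t i ^ k` by `x i ^ k * y i ^ (m i - k)`, where
`y i = ∑ j, z i j * x j`, and taking the coefficient at `m` again. -/
lemma coeff_bosSeries_mul_prod {n : ℕ} (Z : Matrix (Fin n) (Fin n) ℂ) (m : Fin n →₀ ℕ)
    (a b : Fin n → ℂ) :
    MvPowerSeries.coeff m (bosSeries Z *
      ((∏ i, (C (b i) * X i + C (a i)) : MvPolynomial (Fin n) ℂ) : MvPowerSeries (Fin n) ℂ)) =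
    coeff m (∏ i, ((if m i = 0 then 0 else
        C (b i) * X i * (∑ j, C (Z i j) * X j) ^ (m i - 1)) +
      C (a i) * (∑ j, C (Z i j) * X j) ^ m i) : MvPolynomial (Fin n) ℂ) := by
  rw [prod_add, prod_add, ← coeToMvPowerSeries.ringHom_apply, map_sum, mul_sum, map_sum, coeff_sum]
  refine sum_congr rfl fun S _ => ?_
  set e : Fin n →₀ ℕ := ∑ i ∈ S, Finsupp.single i 1 with he
  have he_apply (i : Fin n) : e i = if i ∈ S then 1 else 0 := by
    simp [he, Finsupp.finsetSum_apply, Finsupp.single_apply]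
  have hX : ∏ i ∈ S, (X i : MvPolynomial (Fin n) ℂ) = monomial e 1 := by
    rw [he, monomial_sum_one]; rfl
  have hleft : (∏ i ∈ S, C (b i) * X i) * ∏ i ∈ univ \ S, C (a i) =
      (monomial e ((∏ i ∈ S, b i) * ∏ i ∈ univ \ S, a i) : MvPolynomial (Fin n) ℂ) := by
    rw [prod_mul_distrib, hX, ← map_prod, ← map_prod, mul_right_comm, ← map_mul, C_mul_monomial,
      mul_one]
  rw [hleft, coeToMvPowerSeries.ringHom_apply, coe_monomial, MvPowerSeries.coeff_mul_monomial]
  split_ifs with hle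
  · have hS (i : Fin n) (hi : i ∈ S) : m i ≠ 0 := by
      have := hle i
      rw [he_apply, if_pos hi] at this
      omega
    have hright : (∏ i ∈ S, (if m i = 0 then 0 else
          C (b i) * X i * (∑ j, C (Z i j) * X j) ^ (m i - 1))) *
        ∏ i ∈ univ \ S, C (a i) * (∑ j, C (Z i j) * X j) ^ m i =
        (monomial e ((∏ i ∈ S, b i) * ∏ i ∈ univ \ S, a i) : MvPolynomial (Fin n) ℂ) *
          ∏ i, (∑ j, C (Z i j) * X j) ^ (m - e) i := by
      rw [← hleft, ← prod_sdiff (subset_univ S)]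
      rw [prod_congr rfl fun i hi => if_neg (hS i hi)]
      rw [prod_congr (s₁ := S) (f := fun i => (∑ j, C (Z i j) * X j) ^ (m - e) i) rfl
        fun i hi => by rw [Finsupp.tsub_apply, he_apply, if_pos hi]]
      rw [prod_congr (s₁ := univ \ S) (f := fun i => (∑ j, C (Z i j) * X j) ^ (m - e) i) rfl
        fun i hi => by rw [Finsupp.tsub_apply, he_apply, if_neg (mem_sdiff.1 hi).2, tsub_zero]]
      simp only [prod_mul_distrib]
      ring
    rw [hright, coeff_monomial_mul', if_pos hle, mul_comm]
    rfl
  · obtain ⟨i, hi⟩ : ∃ i, ¬ e i ≤ m i := by simpa [Finsupp.le_def] using hle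
    rw [he_apply] at hi
    have hiS : i ∈ S := by by_contra h; simp [h] at hi
    have hmi : m i = 0 := by simp only [hiS, if_true] at hi; omega
    have hzero : (∏ i ∈ S, (if m i = 0 then 0 else
        C (b i) * X i * (∑ j, C (Z i j) * X j) ^ (m i - 1)) : MvPolynomial (Fin n) ℂ) = 0 :=
      prod_eq_zero hiS (if_pos hmi)
    rw [hzero, zero_mul, coeff_zero]

/-- Setting to zero the variables that do not occur in the monomial `m` does not change the
coefficient at `m`. -/
lemma coeff_aeval_ite_zero {σ R : Type*} [CommSemiring R] (m : σ →₀ ℕ) (p : MvPolynomial σ R) :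
    coeff m (aeval (fun i => if m i = 0 then 0 else X i) p : MvPolynomial σ R) = coeff m p := by
  classical
  induction p using MvPolynomial.induction_on' with
  | monomial u r =>
    rw [aeval_monomial, algebraMap_eq, coeff_C_mul, coeff_monomial]
    by_cases h : ∃ i ∈ u.support, m i = 0
    · obtain ⟨i, hi, hmi⟩ := h
      have hne : u ≠ m := by
        rintro rfl
        exact Finsupp.mem_support_iff.1 hi hmi
      have hprod : (u.prod fun i k => (if m i = 0 then 0 else X i : MvPolynomial σ R) ^ k) = 0 :=
        Finset.prod_eq_zero hi (by simp only [if_pos hmi, zero_pow (Finsupp.mem_support_iff.1 hi)])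
      rw [if_neg hne, hprod, coeff_zero, mul_zero]
    · push Not at h
      have hprod : (u.prod fun i k => (if m i = 0 then 0 else X i : MvPolynomial σ R) ^ k) =
          monomial u 1 := by
        rw [monomial_eq, C_1, one_mul]
        exact Finsupp.prod_congr fun i hi => by rw [if_neg (h i hi)]
      rw [hprod, coeff_monomial, mul_ite, mul_one, mul_zero]
  | add p q hp hq => rw [map_add, coeff_add, coeff_add, hp, hq]

/-- The coefficient at `m ≠ 0` of the homogenized determinant vanishes: once the variables outside
the support of `m` are set to zero, the matrix has a nonzero kernel vector. -/
lemma coeff_mul_det_eq_zero {n : ℕ} (Z : Matrix (Fin n) (Fin n) ℂ) {m : Fin n →₀ ℕ} (hm : m ≠ 0)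
    (p : MvPolynomial (Fin n) ℂ) :
    coeff m (p * (Matrix.of fun j i : Fin n =>
      (if m i = 0 then 0 else C (-Z j i) * X i) + C ((1 : Matrix (Fin n) (Fin n) ℂ) j i) *
        (if m i = 0 then 1 else ∑ k, C (Z i k) * X k) : Matrix _ _ (MvPolynomial (Fin n) ℂ)).det) =
      0 := by
  rw [← coeff_aeval_ite_zero, map_mul, AlgHom.map_det]
  set ψ : MvPolynomial (Fin n) ℂ →ₐ[ℂ] MvPolynomial (Fin n) ℂ :=
    aeval fun i => if m i = 0 then 0 else X i with hψ
  obtain ⟨i₀, hi₀⟩ := Finsupp.ne_iff.1 hm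
  rw [Matrix.exists_mulVec_eq_zero_iff.1, mul_zero, coeff_zero]
  refine ⟨fun i => if m i = 0 then ψ (∑ k, C (Z i k) * X k) else 1, fun h => ?_, ?_⟩
  · simpa [show m i₀ ≠ 0 from hi₀] using congrFun h i₀
  · have hC (c : ℂ) : ψ (C c) = C c := ψ.commutes c
    have hX (i : Fin n) : ψ (X i) = if m i = 0 then 0 else X i := aeval_X _ i
    ext1 j
    have hterm (i : Fin n) : ψ ((if m i = 0 then 0 else C (-Z j i) * X i) +
          C ((1 : Matrix (Fin n) (Fin n) ℂ) j i) *
            (if m i = 0 then 1 else ∑ k, C (Z i k) * X k)) *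
          (if m i = 0 then ψ (∑ k, C (Z i k) * X k) else 1) =
        -ψ (C (Z j i) * X i) + if j = i then ψ (∑ k, C (Z i k) * X k) else 0 := by
      by_cases h : m i = 0 <;> by_cases hji : j = i <;>
        simp [h, hji, hC, hX, Matrix.one_apply]
    simp only [Matrix.mulVec, dotProduct, AlgHom.mapMatrix_apply, Matrix.map_apply, Matrix.of_apply,
      Pi.zero_apply, hterm]
    rw [Finset.sum_add_distrib, Finset.sum_neg_distrib, ← map_sum, Finset.sum_ite_eq,
      if_pos (Finset.mem_univ j), neg_add_cancel]

/-- **MacMahon Master Theorem.** For an `n × n` complex matrix `Z`,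
`(∑_m G(m) t₁^{m₁} ⋯ t_n^{m_n}) · det(I_n − Z T) = 1` in `ℂ[[t₁,…,t_n]]`,
where `T = diag(t₁,…,t_n)` (so `Z T` has `(i,j)`-entry `z_{ij} t_j`). -/
theorem macMahon_master_theorem (n : ℕ) (hn : 1 ≤ n) (Z : Matrix (Fin n) (Fin n) ℂ) :
    bosSeries Z *
      ((1 - Matrix.of fun i j : Fin n => C (Z i j) * X j :
          Matrix (Fin n) (Fin n) (MvPolynomial (Fin n) ℂ)).det :
        MvPowerSeries (Fin n) ℂ) = 1 := by
  classical
  ext m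
  set M : Matrix (Fin n) (Fin n) (MvPolynomial (Fin n) ℂ) := Matrix.of fun j i =>
    (if m i = 0 then 0 else C (-Z j i) * X i * (∑ k, C (Z i k) * X k) ^ (m i - 1)) +
      C ((1 : Matrix (Fin n) (Fin n) ℂ) j i) * (∑ k, C (Z i k) * X k) ^ m i with hM
  have hentry (j i : Fin n) : (1 - Matrix.of fun i j : Fin n => C (Z i j) * X j :
      Matrix (Fin n) (Fin n) (MvPolynomial (Fin n) ℂ)) j i =
      C (-Z j i) * X i + C ((1 : Matrix (Fin n) (Fin n) ℂ) j i) := by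
    by_cases h : j = i <;> simp [Matrix.one_apply, h, sub_eq_neg_add]
  have hdet : MvPowerSeries.coeff m (bosSeries Z *
      ((1 - Matrix.of fun i j : Fin n => C (Z i j) * X j :
          Matrix (Fin n) (Fin n) (MvPolynomial (Fin n) ℂ)).det :
        MvPowerSeries (Fin n) ℂ)) = coeff m M.det := by
    rw [Matrix.det_apply, Matrix.det_apply, ← coeToMvPowerSeries.ringHom_apply, map_sum,
      Finset.mul_sum, map_sum, coeff_sum]
    refine Finset.sum_congr rfl fun σ _ => ?_
    simp only [hentry, hM, Matrix.of_apply]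
    have key := coeff_bosSeries_mul_prod Z m (fun i => (1 : Matrix (Fin n) (Fin n) ℂ) (σ i) i)
      fun i => -Z (σ i) i
    rw [← coeToMvPowerSeries.ringHom_apply] at key
    rcases Int.units_eq_one_or (Equiv.Perm.sign σ) with h | h
    · simpa only [h, one_smul] using key
    · simpa only [h, Units.neg_smul, one_smul, map_neg, mul_neg, coeff_neg, neg_inj] using key
  rw [hdet, MvPowerSeries.coeff_one]
  split_ifs with hm
  · have hone : M = 1 := by
      ext1 j i
      by_cases h : j = i <;> simp [hM, hm, Matrix.one_apply, h]
    rw [hone, Matrix.det_one, hm, coeff_zero_one]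
  · have hfactor : M.det = (∏ i, (∑ k, C (Z i k) * X k) ^ (m i - 1)) *
        (Matrix.of fun j i : Fin n =>
          (if m i = 0 then 0 else C (-Z j i) * X i) + C ((1 : Matrix (Fin n) (Fin n) ℂ) j i) *
            (if m i = 0 then 1 else ∑ k, C (Z i k) * X k)).det := by
      rw [← Matrix.det_mul_row]
      congr 1
      ext1 j i
      simp only [hM, Matrix.of_apply]
      split_ifs with h
      · simp [h]
      · conv_lhs => rw [← pow_sub_one_mul h]
        ring
    rw [hfactor, coeff_mul_det_eq_zero Z hm]
end
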